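/- arXiv:2009.00282 — 6 statements merged into one kernel-verified Lean document; each statement's English description precedes it below -/
import Mathlib

section
/- Let 𝒟 = (𝒫,ℬ) be a 2-(v,k,λ) design, let G ≤ Aut(𝒟) be block-transitive, and suppose v = cd with integers c ≥ 2, d ≥ 2, and that G leaves invariant a partition 𝒞 of 𝒫 with d classes each of size c. Then for every block B ∈ ℬ: the number n of inner pairs contained in B is a positive integer; the number of outer pairs contained in B is divisible by c, say equal to mc with m a positive integer; and these integers satisfy mc = k(k−1)/2 − n and nd = k(k−1)/2 − m (equivalently, c = (k(k−1)/2 − n)/m and d = (k(k−1)/2 − m)/n). -/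
open Finset

/-- Number of inner pairs of `B` with respect to the partition `𝒞`:
2-subsets of `B` contained in a single class of `𝒞`. -/
def innerPairs {P : Type*} [DecidableEq P] (𝒞 : Finset (Finset P)) (B : Finset P) : ℕ :=
  ((B.powersetCard 2).filter (fun p => ∃ C ∈ 𝒞, p ⊆ C)).card

/-- Number of outer pairs of `B` with respect to the partition `𝒞`:
2-subsets of `B` not contained in a single class of `𝒞`. -/
def outerPairs {P : Type*} [DecidableEq P] (𝒞 : Finset (Finset P)) (B : Finset P) : ℕ :=
  ((B.powersetCard 2).filter (fun p => ¬ ∃ C ∈ 𝒞, p ⊆ C)).card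

/-- The rank of a permutation group `X ≤ Sym(Ω)`: the number of `X`-orbits on `Ω × Ω`. -/
noncomputable def permRank {Ω : Type*} (X : Subgroup (Equiv.Perm Ω)) : ℕ :=
  Nat.card {O : Set (Ω × Ω) // ∃ p : Ω × Ω, O = {q | ∃ g ∈ X, (g p.1, g p.2) = q}}

/-- The pair-rank of a permutation group `X ≤ Sym(Ω)`: the number of `X`-orbits on
the 2-element subsets of `Ω`. -/
noncomputable def permPairRank {Ω : Type*} [DecidableEq Ω] (X : Subgroup (Equiv.Perm Ω)) : ℕ :=
  Nat.card {O : Set (Finset Ω) // ∃ s : Finset Ω, s.card = 2 ∧ O = {t | ∃ g ∈ X, s.image ⇑g = t}}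

/-- If the property `Q` of 2-subsets is preserved by `G`, then the number of `Q`-pairs in a block is
the same for all blocks, and double counting relates it to the total number of `Q`-pairs. -/
theorem card_blocks_mul_card_filter_pairs
    {P : Type*} [Fintype P] [DecidableEq P] {lam : ℕ} {ℬ : Finset (Finset P)}
    (hdesign : ∀ p : Finset P, p.card = 2 → (ℬ.filter fun B => p ⊆ B).card = lam)
    {G : Subgroup (Equiv.Perm P)}
    (hGtrans : ∀ B₁ ∈ ℬ, ∀ B₂ ∈ ℬ, ∃ g ∈ G, B₁.image ⇑g = B₂)
    (Q : Finset P → Prop) [DecidablePred Q]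
    (hQ : ∀ g ∈ G, ∀ p, Q p → Q (p.image ⇑g)) {B : Finset P} (hB : B ∈ ℬ) :
    ℬ.card * ((B.powersetCard 2).filter Q).card =
      lam * ((powersetCard 2 (univ : Finset P)).filter Q).card := by
  have hle : ∀ B₁ ∈ ℬ, ∀ B₂ ∈ ℬ,
      ((B₁.powersetCard 2).filter Q).card ≤ ((B₂.powersetCard 2).filter Q).card := by
    intro B₁ h₁ B₂ h₂
    obtain ⟨g, hg, rfl⟩ := hGtrans B₁ h₁ B₂ h₂
    refine card_le_card_of_injOn (fun p => p.image ⇑g) ?_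
      (Finset.image_injective g.injective).injOn
    intro p hp
    simp only [coe_filter, mem_powersetCard, Set.mem_ofPred_eq] at hp ⊢
    exact ⟨⟨image_subset_image hp.1.1, by rw [card_image_of_injective _ g.injective, hp.1.2]⟩,
      hQ g hg p hp.2⟩
  have hcount := sum_card_bipartiteAbove_eq_sum_card_bipartiteBelow (s := ℬ)
    (t := (powersetCard 2 (univ : Finset P)).filter Q) (fun B p => p ⊆ B)
  have habove : ∀ B' ∈ ℬ, (bipartiteAbove (fun B p => p ⊆ B)
      ((powersetCard 2 (univ : Finset P)).filter Q) B').card =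
        ((B.powersetCard 2).filter Q).card := by
    intro B' hB'
    rw [← le_antisymm (hle B' hB' B hB) (hle B hB B' hB')]
    congr 1
    ext p
    simp only [mem_bipartiteAbove, mem_filter, mem_powersetCard, subset_univ, true_and]
    tauto
  have hbelow : ∀ p ∈ (powersetCard 2 (univ : Finset P)).filter Q,
      (bipartiteBelow (fun B p => p ⊆ B) ℬ p).card = lam := by
    intro p hp
    exact hdesign p (mem_powersetCard.1 (mem_filter.1 hp).1).2
  rw [sum_congr rfl habove, sum_congr rfl hbelow, sum_const, sum_const, smul_eq_mul,
    smul_eq_mul] at hcount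
  rw [hcount, mul_comm]

/-- The number of pairs inside the classes of a partition into `d` classes of size `c`. -/
theorem card_filter_exists_subset_class
    {P : Type*} [Fintype P] [DecidableEq P] {c d : ℕ} {𝒞 : Finset (Finset P)}
    (h𝒞d : 𝒞.card = d) (h𝒞c : ∀ C ∈ 𝒞, C.card = c)
    (h𝒞part : ∀ x : P, ∃! C, C ∈ 𝒞 ∧ x ∈ C) :
    ((powersetCard 2 (univ : Finset P)).filter fun p => ∃ C ∈ 𝒞, p ⊆ C).card =
      d * c.choose 2 := by
  have heq : (powersetCard 2 (univ : Finset P)).filter (fun p => ∃ C ∈ 𝒞, p ⊆ C) =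
      𝒞.biUnion (powersetCard 2) := by
    ext p
    simp only [mem_filter, mem_powersetCard, subset_univ, true_and, mem_biUnion]
    constructor
    · rintro ⟨hp, C, hC, hpC⟩
      exact ⟨C, hC, hpC, hp⟩
    · rintro ⟨C, hC, hpC, hp⟩
      exact ⟨hp, C, hC, hpC⟩
  rw [heq, card_biUnion]
  · rw [sum_congr rfl fun C hC => by rw [card_powersetCard, h𝒞c C hC], sum_const, h𝒞d,
      smul_eq_mul]
  · intro C hC D hD hCD
    rw [Function.onFun, disjoint_left]
    intro p hpC hpD
    rw [mem_powersetCard] at hpC hpD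
    obtain ⟨x, hx⟩ : p.Nonempty := card_pos.1 (by omega)
    exact hCD ((h𝒞part x).unique ⟨hC, hpC.1 hx⟩ ⟨hD, hpD.1 hx⟩)

/-- The arithmetic of the Delandtsheer–Doyen parameters: `n` inner pairs and `o` outer pairs per
block, `b` blocks. -/
theorem exists_delandtsheer_doyen_parameter {b lam c d n o : ℕ} (hlam : 0 < lam) (hc : 2 ≤ c)
    (hd : 2 ≤ d) (hinner : b * n = lam * (d * c.choose 2))
    (hall : b * (n + o) = lam * (c * d).choose 2) :
    ∃ m, 0 < m ∧ 0 < n ∧ o = m * c ∧ n * d + m = n + o := by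
  have hinner_pos : 0 < b * n := by
    rw [hinner]
    have := Nat.choose_pos hc
    positivity
  have hb : 0 < b := Nat.pos_of_mul_pos_right hinner_pos
  have hn : 0 < n := Nat.pos_of_mul_pos_left hinner_pos
  have hc2 : (c.choose 2 : ℚ) = c * (c - 1) / 2 := Nat.cast_choose_two ℚ c
  have hcd2 : ((c * d).choose 2 : ℚ) = (c * d) * (c * d - 1) / 2 := by
    rw [Nat.cast_choose_two ℚ (c * d)]; push_cast; rfl
  have hbQ : (0 : ℚ) < b := by exact_mod_cast hb
  have hnQ : (0 : ℚ) < n := by exact_mod_cast hn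
  have hcQ : (2 : ℚ) ≤ c := by exact_mod_cast hc
  have hdQ : (2 : ℚ) ≤ d := by exact_mod_cast hd
  have hinnerQ : (b : ℚ) * n = lam * (d * (c * (c - 1) / 2)) := by
    rw [← hc2]; exact_mod_cast hinner
  have hallQ : (b : ℚ) * (n + o) = lam * ((c * d) * (c * d - 1) / 2) := by
    rw [← hcd2]; exact_mod_cast hall
  have key : (n : ℚ) * (c * d - 1) = (n + o) * (c - 1) := by
    apply mul_left_cancel₀ hbQ.ne'
    linear_combination (c * d - 1 : ℚ) * hinnerQ - (c - 1 : ℚ) * hallQ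
  have hpos : (n : ℚ) * d < n + o := by
    have : 0 < ((n : ℚ) + o - n * d) * (c - 1) := by
      have : ((n : ℚ) + o - n * d) * (c - 1) = n * (d - 1) := by linear_combination -key
      rw [this]
      exact mul_pos hnQ (by linarith)
    linarith [pos_of_mul_pos_left this (by linarith)]
  have hlt : n * d < n + o := by exact_mod_cast hpos
  obtain ⟨m, hm⟩ := Nat.exists_eq_add_of_lt hlt
  refine ⟨m + 1, by omega, hn, ?_, by omega⟩
  have hmQ : (n : ℚ) + o = n * d + m + 1 := by exact_mod_cast hm
  have : (o : ℚ) = (m + 1) * c := by linear_combination key + c * hmQ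
  exact_mod_cast this


/-- **Delandtsheer–Doyen Theorem.** For a block-transitive, point-imprimitive `2`-design,
every block contains `n > 0` inner pairs and `m·c` outer pairs (`m > 0`), where
`m·c = C(k,2) − n` and `n·d = C(k,2) − m`. -/
theorem delandtsheer_doyen
    {P : Type*} [Fintype P] [DecidableEq P]
    (c d k lam : ℕ) (hc : 2 ≤ c) (hd : 2 ≤ d) (hlam : 0 < lam)
    (hP : Fintype.card P = c * d)
    (ℬ : Finset (Finset P))
    (hblocksize : ∀ B ∈ ℬ, B.card = k)
    (hdesign : ∀ p : Finset P, p.card = 2 → (ℬ.filter fun B => p ⊆ B).card = lam)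
    (G : Subgroup (Equiv.Perm P))
    (hGaut : ∀ g ∈ G, ∀ B ∈ ℬ, B.image ⇑g ∈ ℬ)
    (hGtrans : ∀ B₁ ∈ ℬ, ∀ B₂ ∈ ℬ, ∃ g ∈ G, B₁.image ⇑g = B₂)
    (𝒞 : Finset (Finset P))
    (h𝒞d : 𝒞.card = d) (h𝒞c : ∀ C ∈ 𝒞, C.card = c)
    (h𝒞part : ∀ x : P, ∃! C, C ∈ 𝒞 ∧ x ∈ C)
    (h𝒞inv : ∀ g ∈ G, ∀ C ∈ 𝒞, C.image ⇑g ∈ 𝒞) :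
    ∀ B ∈ ℬ, ∃ m n : ℕ, 0 < m ∧ 0 < n ∧
      innerPairs 𝒞 B = n ∧ outerPairs 𝒞 B = m * c ∧
      m * c + n = Nat.choose k 2 ∧ n * d + m = Nat.choose k 2 := by
  intro B hB
  have hinner := card_blocks_mul_card_filter_pairs hdesign hGtrans (fun p => ∃ C ∈ 𝒞, p ⊆ C)
    (fun g hg p ⟨C, hC, hpC⟩ => ⟨C.image ⇑g, h𝒞inv g hg C hC, image_subset_image hpC⟩) hB
  rw [card_filter_exists_subset_class h𝒞d h𝒞c h𝒞part] at hinner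
  have hall := card_blocks_mul_card_filter_pairs hdesign hGtrans (fun _ => True)
    (fun _ _ _ _ => trivial) hB
  simp only [filter_true, card_powersetCard, card_univ, hP, hblocksize B hB] at hall
  have hsum : innerPairs 𝒞 B + outerPairs 𝒞 B = k.choose 2 := by
    rw [innerPairs, outerPairs, card_filter_add_card_filter_not, card_powersetCard,
      hblocksize B hB]
  rw [← hsum] at hall
  obtain ⟨m, hm, hn, ho, hnd⟩ := exists_delandtsheer_doyen_parameter hlam hc hd hinner hall
  exact ⟨m, innerPairs 𝒞 B, hm, hn, rfl, ho, by omega, hnd.trans hsum⟩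
end

section
/- Let 𝒟 = (𝒫,ℬ) be a 2-(cd,k,λ) design with c ≥ 2, d ≥ 2, and let m, n be positive integers satisfying mc = k(k−1)/2 − n and nd = k(k−1)/2 − m. Then the number of blocks b = |ℬ| satisfies 2n·b = cd(c−1)λ and 2m·b = cd(d−1)λ. -/
open Finset

/-- Double counting of the flags (pair of points, block containing it) of a `2`-design. -/
theorem card_mul_choose_two_eq {P : Type*} [Fintype P] [DecidableEq P] {k lam : ℕ}
    {ℬ : Finset (Finset P)} (hblocksize : ∀ B ∈ ℬ, B.card = k)
    (hdesign : ∀ p : Finset P, p.card = 2 → (ℬ.filter fun B => p ⊆ B).card = lam) :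
    ℬ.card * k.choose 2 = (Fintype.card P).choose 2 * lam := by
  have hcount := sum_card_bipartiteAbove_eq_sum_card_bipartiteBelow
    (s := powersetCard 2 (univ : Finset P)) (t := ℬ) (fun p B => p ⊆ B)
  rw [sum_const_nat (m := lam), sum_const_nat (m := k.choose 2), card_powersetCard,
    card_univ] at hcount
  · exact hcount.symm
  · intro B hB
    rw [← hblocksize B hB, ← card_powersetCard]
    congr 1
    ext p
    simp [mem_bipartiteBelow, mem_powersetCard, and_comm]
  · intro p hp
    exact hdesign p (mem_powersetCard.1 hp).2

/-- In a `2`-(cd, k, λ) design whose parameters satisfy the Delandtsheer–Doyen equations,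
the number of blocks `b = |ℬ|` satisfies `2n·b = cd(c−1)λ` and `2m·b = cd(d−1)λ`. -/
theorem block_count_identities
    {P : Type*} [Fintype P] [DecidableEq P]
    (c d k lam m n : ℕ) (hc : 2 ≤ c) (hd : 2 ≤ d) (hlam : 0 < lam)
    (hP : Fintype.card P = c * d)
    (ℬ : Finset (Finset P))
    (hblocksize : ∀ B ∈ ℬ, B.card = k)
    (hdesign : ∀ p : Finset P, p.card = 2 → (ℬ.filter fun B => p ⊆ B).card = lam)
    (hm : 0 < m) (hn : 0 < n)
    (h1 : m * c = Nat.choose k 2 - n)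
    (h2 : n * d = Nat.choose k 2 - m) :
    2 * n * ℬ.card = c * d * (c - 1) * lam ∧
    2 * m * ℬ.card = c * d * (d - 1) * lam := by
  have hflags := card_mul_choose_two_eq hblocksize hdesign
  obtain ⟨x, rfl⟩ := Nat.exists_eq_add_of_le' (show 1 ≤ c by omega)
  obtain ⟨y, rfl⟩ := Nat.exists_eq_add_of_le' (show 1 ≤ d by omega)
  have hv : (x + 1) * (y + 1) = (x * y + x + y) + 1 := by ring
  have hpairs := Nat.add_one_mul_choose_eq (x * y + x + y) 1
  rw [Nat.choose_one_right, one_add_one_eq_two] at hpairs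
  rw [hP, hv] at hflags
  have hmc : 0 < m * (x + 1) := by positivity
  have hnd : 0 < n * (y + 1) := by positivity
  have h1' : m * (x + 1) + n = k.choose 2 := by omega
  have h2' : n * (y + 1) + m = k.choose 2 := by omega
  have hpos : 0 < x * y + x + y := by
    have : 0 < x := by omega
    positivity
  simp only [Nat.add_sub_cancel]
  rw [hv]
  generalize k.choose 2 = K at *
  generalize (x * y + x + y + 1).choose 2 = V at *
  have hKx : K * x = n * (x * y + x + y) := by
    linarith [congrArg (· * (x + 1)) h2']
  have hKy : K * y = m * (x * y + x + y) := by
    linarith [congrArg (· * (y + 1)) h1']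
  constructor <;> apply Nat.eq_of_mul_eq_mul_left hpos
  · linear_combination 2 * ℬ.card * hKx.symm + 2 * x * hflags + x * lam * hpairs.symm
  · linear_combination 2 * ℬ.card * hKy.symm + 2 * y * hflags + y * lam * hpairs.symm
end

section
/- Let 𝒟 = (𝒫,ℬ) be a 2-(cd,k,λ) design with c ≥ 2, d ≥ 2, let G ≤ Aut(𝒟) be block-transitive leaving invariant a partition 𝒞 of 𝒫 with d classes each of size c, let m, n be the Delandtsheer–Doyen parameters (every block contains exactly n inner pairs and exactly mc outer pairs), and let H = G_C^C be the permutation group induced on a class C by its setwise stabiliser. If Rank(H) = 2n + 1, then |H| is odd, and for every α ∈ C every orbit of the point stabiliser H_α on C \ {α} has size (c−1)/(2n); in particular H is 3/2-transitive on C. -/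
open Finset

section Design

variable {P : Type*} [DecidableEq P] {ℬ : Finset (Finset P)} {lam : ℕ}

/-- The blocks of a design containing two given distinct points. -/
lemma card_blocks_of_ne
    (hdesign : ∀ p : Finset P, p.card = 2 → (ℬ.filter fun B => p ⊆ B).card = lam)
    {x y : P} (h : x ≠ y) : (ℬ.filter fun B => x ∈ B ∧ y ∈ B).card = lam := by
  rw [← hdesign {x, y} (card_pair h)]
  simp [insert_subset_iff]

/-- Flag counting for a set of ordered pairs of distinct points meeting all blocks equally. -/
lemma card_pairs_mul_eq
    (hdesign : ∀ p : Finset P, p.card = 2 → (ℬ.filter fun B => p ⊆ B).card = lam)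
    {S : Finset (P × P)} {a : ℕ} (hS : ∀ p ∈ S, p.1 ≠ p.2)
    (ha : ∀ B ∈ ℬ, (S.filter fun p => p.1 ∈ B ∧ p.2 ∈ B).card = a) :
    S.card * lam = ℬ.card * a := by
  have h := sum_card_bipartiteAbove_eq_sum_card_bipartiteBelow (s := S) (t := ℬ)
    (fun p B => p.1 ∈ B ∧ p.2 ∈ B)
  rw [sum_congr rfl (g := fun _ => lam), sum_congr rfl (s₁ := ℬ) (g := fun _ => a)] at h
  · simpa using h
  · exact ha
  · exact fun p hp => card_blocks_of_ne hdesign (hS p hp)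

/-- Counting the pairs `(y, B)` with `y ∈ X` and `x, y ∈ B`. -/
lemma replication_mul_eq
    (hdesign : ∀ p : Finset P, p.card = 2 → (ℬ.filter fun B => p ⊆ B).card = lam)
    {x : P} {X : Finset P} {a : ℕ} (hx : x ∉ X)
    (ha : ∀ B ∈ ℬ, x ∈ B → (X.filter fun y => y ∈ B).card = a) :
    (ℬ.filter fun B => x ∈ B).card * a = X.card * lam := by
  have h := sum_card_bipartiteAbove_eq_sum_card_bipartiteBelow (s := X)
    (t := ℬ.filter fun B => x ∈ B) (fun y B => y ∈ B)
  rw [sum_congr rfl (g := fun _ => lam), sum_congr rfl (s₁ := ℬ.filter _) (g := fun _ => a)] at h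
  · simpa using h.symm
  · intro B hB
    exact ha B (mem_filter.1 hB).1 (mem_filter.1 hB).2
  · intro y hy
    rw [bipartiteAbove, filter_filter]
    exact card_blocks_of_ne hdesign (fun e => hx (e ▸ hy))

/-- A group acting transitively on the blocks of a design whose blocks are proper subsets of the
point set is transitive on points. -/
lemma exists_apply_eq_of_block_transitive [Fintype P] {k : ℕ} (hlam : 0 < lam)
    (hblocksize : ∀ B ∈ ℬ, B.card = k)
    (hdesign : ∀ p : Finset P, p.card = 2 → (ℬ.filter fun B => p ⊆ B).card = lam)
    {G : Subgroup (Equiv.Perm P)}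
    (hGtrans : ∀ B₁ ∈ ℬ, ∀ B₂ ∈ ℬ, ∃ g ∈ G, B₁.image ⇑g = B₂)
    (hk : k < Fintype.card P) (x y : P) : ∃ g ∈ G, g x = y := by
  classical
  by_contra hxy
  set X : Finset P := univ.filter fun z => ∃ g ∈ G, g x = z with hX
  have hxX : x ∈ X := by simpa [hX] using ⟨1, G.one_mem, rfl⟩
  have hyX : y ∉ X := by simpa [hX] using hxy
  have hne : x ≠ y := fun e => hyX (e ▸ hxX)
  obtain ⟨B, hB⟩ : (ℬ.filter fun B => x ∈ B ∧ y ∈ B).Nonempty := by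
    rw [← card_pos, card_blocks_of_ne hdesign hne]; exact hlam
  obtain ⟨hB, hxB, hyB⟩ := mem_filter.1 hB
  have hinter : ∀ B' ∈ ℬ, (X.filter fun z => z ∈ B').card = (X.filter fun z => z ∈ B).card := by
    intro B' hB'
    obtain ⟨g, hg, rfl⟩ := hGtrans B hB B' hB'
    symm
    refine card_bij (fun z _ => g z) ?_ (fun _ _ _ _ h => g.injective h) ?_
    · simp only [hX, mem_filter, mem_univ, true_and]
      rintro z ⟨⟨u, hu, rfl⟩, hz⟩
      exact ⟨⟨g * u, G.mul_mem hg hu, rfl⟩, mem_image_of_mem _ hz⟩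
    · simp only [hX, mem_filter, mem_univ, true_and, mem_image]
      rintro _ ⟨⟨u, hu, hz⟩, w, hw, rfl⟩
      exact ⟨w, ⟨⟨g⁻¹ * u, G.mul_mem (G.inv_mem hg) hu, by simp [hz]⟩, hw⟩, rfl⟩
  have hr : ∀ z, (ℬ.filter fun B => z ∈ B).card * (k - 1) = (Fintype.card P - 1) * lam := by
    intro z
    rw [replication_mul_eq hdesign (X := univ.erase z) (notMem_erase _ _) (a := k - 1),
      card_erase_of_mem (mem_univ _), card_univ]
    intro B' hB' hz
    rw [← hblocksize B' hB', ← card_erase_of_mem hz]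
    congr 1
    ext w; simp
  have h1 := replication_mul_eq hdesign (X := X.erase x) (x := x) (notMem_erase _ _)
    (a := (X.filter fun z => z ∈ B).card - 1) (by
      intro B' hB' hx'
      rw [← hinter B' hB', filter_erase, card_erase_of_mem (mem_filter.2 ⟨hxX, hx'⟩)])
  have h2 := replication_mul_eq hdesign (X := X) (x := y) hyX (fun B' hB' _ => hinter B' hB')
  rw [card_erase_of_mem hxX] at h1
  have hk2 : 2 ≤ k := by
    rw [← hblocksize B hB, ← card_pair hne]
    exact card_le_card (by simp [insert_subset_iff, hxB, hyB])
  have hreq : (ℬ.filter fun B => x ∈ B).card = (ℬ.filter fun B => y ∈ B).card :=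
    Nat.eq_of_mul_eq_mul_right (by omega : 0 < k - 1) ((hr x).trans (hr y).symm)
  have ha : 0 < (X.filter fun z => z ∈ B).card := card_pos.2 ⟨x, mem_filter.2 ⟨hxX, hxB⟩⟩
  have hXpos : 0 < X.card := card_pos.2 ⟨x, hxX⟩
  have hrx := hr x
  rw [← hreq] at h2
  generalize (ℬ.filter fun B => x ∈ B).card = r at *
  generalize (X.filter fun z => z ∈ B).card = a at *
  obtain ⟨a, rfl⟩ : ∃ b, a = b + 1 := ⟨a - 1, by omega⟩
  obtain ⟨s, hs⟩ : ∃ s, X.card = s + 1 := ⟨X.card - 1, by omega⟩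
  rw [hs] at h1 h2
  simp only [Nat.add_sub_cancel] at h1 h2
  have hrl : r = lam := by nlinarith
  subst hrl
  have := Nat.eq_of_mul_eq_mul_right hlam ((mul_comm _ _).trans hrx)
  omega

/-- The ordered pairs of distinct points of `B` lying in a common class. -/
def innerOffDiag (𝒞 : Finset (Finset P)) (B : Finset P) : Finset (P × P) :=
  B.offDiag.filter fun p => ∃ C ∈ 𝒞, p.1 ∈ C ∧ p.2 ∈ C

lemma mem_innerOffDiag {𝒞 : Finset (Finset P)} {B : Finset P} {p : P × P} :
    p ∈ innerOffDiag 𝒞 B ↔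
      (p.1 ∈ B ∧ p.2 ∈ B ∧ p.1 ≠ p.2) ∧ ∃ C ∈ 𝒞, p.1 ∈ C ∧ p.2 ∈ C := by
  simp [innerOffDiag]

lemma card_innerOffDiag (𝒞 : Finset (Finset P)) (B : Finset P) :
    (innerOffDiag 𝒞 B).card = 2 * innerPairs 𝒞 B := by
  rw [innerPairs, card_eq_sum_card_fiberwise (f := fun p : P × P => ({p.1, p.2} : Finset P))
    (t := (B.powersetCard 2).filter (fun p => ∃ C ∈ 𝒞, p ⊆ C))]
  · rw [sum_const_nat (m := 2), mul_comm]
    intro s hs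
    obtain ⟨hs, D, hD, hsD⟩ := mem_filter.1 hs
    obtain ⟨hsB, hs2⟩ := mem_powersetCard.1 hs
    obtain ⟨a, b, hab, rfl⟩ := card_eq_two.1 hs2
    rw [← card_pair (show ((a, b) : P × P) ≠ (b, a) from fun h => hab (congrArg Prod.fst h))]
    congr 1
    simp only [insert_subset_iff, singleton_subset_iff] at hsB hsD
    ext ⟨u, v⟩
    simp only [mem_filter, mem_innerOffDiag, mem_insert, mem_singleton, Prod.mk.injEq]
    constructor
    · rintro ⟨⟨⟨-, -, huv⟩, -⟩, he⟩
      have hu : u ∈ ({a, b} : Finset P) := he ▸ by simp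
      have hv : v ∈ ({a, b} : Finset P) := he ▸ by simp
      simp only [mem_insert, mem_singleton] at hu hv
      grind
    · rintro (⟨rfl, rfl⟩ | ⟨rfl, rfl⟩)
      · exact ⟨⟨⟨hsB.1, hsB.2, hab⟩, D, hD, hsD⟩, rfl⟩
      · exact ⟨⟨⟨hsB.2, hsB.1, hab.symm⟩, D, hD, hsD.symm⟩, pair_comm _ _⟩
  · intro p hp
    obtain ⟨⟨h1, h2, h3⟩, D, hD, h4, h5⟩ := mem_innerOffDiag.1 hp
    simp only [coe_filter, Set.mem_ofPred_eq, mem_powersetCard]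
    exact ⟨⟨by simp [insert_subset_iff, h1, h2], card_pair h3⟩, D, hD,
      by simp [insert_subset_iff, h4, h5]⟩

/-- An invariant set of ordered pairs has equally many elements above every point. -/
lemma card_eq_card_mul_fiber [Fintype P] {G : Subgroup (Equiv.Perm P)}
    (htrans : ∀ x y : P, ∃ g ∈ G, g x = y) {S : Finset (P × P)}
    (hS : ∀ g ∈ G, ∀ p ∈ S, (g p.1, g p.2) ∈ S) (x : P) :
    S.card = Fintype.card P * (univ.filter fun y => (x, y) ∈ S).card := by
  rw [card_eq_sum_card_fiberwise (f := Prod.fst) (t := univ) (by simp [Set.MapsTo]),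
    sum_const_nat (m := (univ.filter fun y => (x, y) ∈ S).card), card_univ]
  intro z _
  obtain ⟨g, hg, rfl⟩ := htrans x z
  symm
  refine card_bij (fun y _ => (g x, g y)) ?_ ?_ ?_
  · intro y hy
    simpa using hS g hg _ (mem_filter.1 hy).2
  · intro y _ z _ h
    exact g.injective (congrArg Prod.snd h)
  · rintro ⟨u, v⟩ h
    obtain ⟨h, rfl : u = g x⟩ := mem_filter.1 h
    exact ⟨g⁻¹ v, by simpa using hS g⁻¹ (G.inv_mem hg) _ h, by simp⟩

end Design

section Class

variable {P : Type*} [DecidableEq P] {G : Subgroup (Equiv.Perm P)} {𝒞 : Finset (Finset P)}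
  {C : Finset P} {H : Subgroup (Equiv.Perm {x // x ∈ C})}

/-- A group element sending a point of the class `C` into `C` stabilises `C`, so it induces an
element of `H`. -/
lemma exists_mem_induced_of_apply_mem
    (h𝒞part : ∀ x : P, ∃! C, C ∈ 𝒞 ∧ x ∈ C)
    (h𝒞inv : ∀ g ∈ G, ∀ C ∈ 𝒞, C.image ⇑g ∈ 𝒞) (hC : C ∈ 𝒞)
    (hH : ∀ h : Equiv.Perm {x // x ∈ C},
      h ∈ H ↔ ∃ g ∈ G, ∀ x : {x // x ∈ C}, (↑(h x) : P) = g ↑x)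
    {g : Equiv.Perm P} (hg : g ∈ G) {x : P} (hx : x ∈ C) (hgx : g x ∈ C) :
    ∃ h ∈ H, ∀ z : {x // x ∈ C}, (↑(h z) : P) = g z := by
  have him : C.image g = C :=
    (h𝒞part (g x)).unique ⟨h𝒞inv g hg C hC, mem_image_of_mem _ hx⟩ ⟨hC, hgx⟩
  have hmem : ∀ z, g z ∈ C ↔ z ∈ C := by
    intro z
    conv_lhs => rw [← him]
    simp
  exact ⟨g.subtypePerm hmem, (hH _).2 ⟨g, hg, fun _ => rfl⟩, fun _ => rfl⟩

end Class

/-- If `Rank(H) = 2n + 1` (the maximum possible), then `|H|` is odd and every orbit of a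
point stabiliser `H_α` on `C \ {α}` has size `(c−1)/(2n)`; in particular `H` is
`3/2`-transitive on `C`. -/
theorem max_rank_H
    {P : Type*} [Fintype P] [DecidableEq P]
    (c d k lam m n : ℕ) (hc : 2 ≤ c) (hd : 2 ≤ d) (hlam : 0 < lam)
    (hP : Fintype.card P = c * d)
    (ℬ : Finset (Finset P))
    (hblocksize : ∀ B ∈ ℬ, B.card = k)
    (hdesign : ∀ p : Finset P, p.card = 2 → (ℬ.filter fun B => p ⊆ B).card = lam)
    (G : Subgroup (Equiv.Perm P))
    (hGaut : ∀ g ∈ G, ∀ B ∈ ℬ, B.image ⇑g ∈ ℬ)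
    (hGtrans : ∀ B₁ ∈ ℬ, ∀ B₂ ∈ ℬ, ∃ g ∈ G, B₁.image ⇑g = B₂)
    (𝒞 : Finset (Finset P))
    (h𝒞d : 𝒞.card = d) (h𝒞c : ∀ C ∈ 𝒞, C.card = c)
    (h𝒞part : ∀ x : P, ∃! C, C ∈ 𝒞 ∧ x ∈ C)
    (h𝒞inv : ∀ g ∈ G, ∀ C ∈ 𝒞, C.image ⇑g ∈ 𝒞)
    (hm : 0 < m) (hn : 0 < n)
    (hinner : ∀ B ∈ ℬ, innerPairs 𝒞 B = n)
    (houter : ∀ B ∈ ℬ, outerPairs 𝒞 B = m * c)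
    (C : Finset P) (hC : C ∈ 𝒞)
    (H : Subgroup (Equiv.Perm {x // x ∈ C}))
    (hH : ∀ h : Equiv.Perm {x // x ∈ C},
      h ∈ H ↔ ∃ g ∈ G, ∀ x : {x // x ∈ C}, (↑(h x) : P) = g ↑x)
    (hrank : permRank H = 2 * n + 1) :
    Odd (Nat.card H) ∧
    ∀ α β : {x // x ∈ C}, β ≠ α →
      2 * n * Set.ncard {γ : {x // x ∈ C} | ∃ h ∈ H, h α = α ∧ h β = γ} = c - 1 := by
  classical
  have hCcard : C.card = c := h𝒞c C hC
  have hinnerOff : ∀ B ∈ ℬ, ((innerOffDiag 𝒞 univ).filter fun p => p.1 ∈ B ∧ p.2 ∈ B).card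
      = 2 * n := by
    intro B hB
    rw [← hinner B hB, ← card_innerOffDiag]
    congr 1
    ext p
    simp only [mem_filter, mem_innerOffDiag, mem_univ, true_and]
    tauto
  have hclass : ∀ x y D, D ∈ 𝒞 → x ∈ D → ((∃ E ∈ 𝒞, x ∈ E ∧ y ∈ E) ↔ y ∈ D) := by
    refine fun x y D hD hx => ⟨?_, fun hy => ⟨D, hD, hx, hy⟩⟩
    rintro ⟨E, hE, hxE, hyE⟩
    rwa [(h𝒞part x).unique ⟨hD, hx⟩ ⟨hE, hxE⟩]
  have hinnerCard : (innerOffDiag 𝒞 univ).card = Fintype.card P * (c - 1) := by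
    rw [card_eq_sum_card_fiberwise (f := Prod.fst) (t := univ) (by simp [Set.MapsTo]),
      sum_const_nat (m := c - 1), card_univ]
    intro x _
    obtain ⟨D, ⟨hD, hx⟩, -⟩ := h𝒞part x
    rw [← h𝒞c D hD, ← card_erase_of_mem hx]
    symm
    refine card_bij (fun y _ => (x, y)) ?_ (by simp) ?_
    · intro y hy
      obtain ⟨hne, hy⟩ := mem_erase.1 hy
      exact mem_filter.2
        ⟨mem_innerOffDiag.2 ⟨⟨mem_univ _, mem_univ _, hne.symm⟩, D, hD, hx, hy⟩, rfl⟩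
    · rintro ⟨u, v⟩ h
      obtain ⟨huv, rfl : u = x⟩ := mem_filter.1 h
      obtain ⟨⟨-, -, hne⟩, hE⟩ := mem_innerOffDiag.1 huv
      exact ⟨v, mem_erase.2 ⟨hne.symm, (hclass u v D hD hx).1 hE⟩, rfl⟩
  have hflags := card_pairs_mul_eq hdesign (S := innerOffDiag 𝒞 univ)
    (fun p hp => (mem_innerOffDiag.1 hp).1.2.2) hinnerOff
  -- a block exists and is a proper subset of the point set
  obtain ⟨x₀, hx₀, y₀, hy₀, hxy₀⟩ := one_lt_card.1 (show 1 < C.card by omega)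
  obtain ⟨B, hB⟩ : ∃ B, B ∈ ℬ := by
    have : (ℬ.filter fun B => x₀ ∈ B ∧ y₀ ∈ B).Nonempty := by
      rw [← card_pos, card_blocks_of_ne hdesign hxy₀]; exact hlam
    exact this.imp fun B h => (mem_filter.1 h).1
  have hk : k < Fintype.card P := by
    rw [← hblocksize B hB]
    refine lt_of_le_of_ne (card_le_univ B) fun h => ?_
    have hBu : B = univ := (card_eq_iff_eq_univ B).1 h
    have h1 : 2 * n = c * d * (c - 1) := by
      rw [← hP, ← hinnerCard, ← hinner B hB, ← card_innerOffDiag, hBu]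
    have h2 : permRank H ≤ c * c := by
      have := Nat.card_le_card_of_surjective
        (fun p : {x // x ∈ C} × {x // x ∈ C} =>
          (⟨_, p, rfl⟩ : {O : Set ({x // x ∈ C} × {x // x ∈ C}) //
            ∃ p, O = {q | ∃ g ∈ H, (g p.1, g p.2) = q}}))
        (by rintro ⟨_, p, rfl⟩; exact ⟨p, rfl⟩)
      rwa [Nat.card_prod, Nat.card_eq_fintype_card (α := {x // x ∈ C}), Fintype.card_coe, hCcard] at this
    rw [hrank, h1] at h2
    obtain ⟨e, rfl⟩ : ∃ e, c = e + 2 := ⟨c - 2, by omega⟩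
    obtain ⟨f, rfl⟩ : ∃ f, d = f + 2 := ⟨d - 2, by omega⟩
    have h3 : e + 2 - 1 = e + 1 := by omega
    rw [h3] at h2
    nlinarith [Nat.zero_le (e * f), Nat.zero_le (e * e * f)]
  have htrans := exists_apply_eq_of_block_transitive hlam hblocksize hdesign hGtrans hk
  have hlift := fun {g : Equiv.Perm P} =>
    exists_mem_induced_of_apply_mem (g := g) h𝒞part h𝒞inv hC hH
  -- the `H`-orbits on pairs are the traces of the `G`-orbits
  have horbit : ∀ p q : {x // x ∈ C} × {x // x ∈ C},
      (∃ h ∈ H, (h p.1, h p.2) = q) ↔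
        ∃ g ∈ G, (g (p.1 : P), g (p.2 : P)) = ((q.1 : P), (q.2 : P)) := by
    rintro ⟨a, b⟩ ⟨a', b'⟩
    simp only [Prod.mk.injEq]
    constructor
    · rintro ⟨h, hh, rfl, rfl⟩
      obtain ⟨g, hg, hgh⟩ := (hH h).1 hh
      exact ⟨g, hg, (hgh _).symm, (hgh _).symm⟩
    · rintro ⟨g, hg, h1, h2⟩
      obtain ⟨h, hh, hgh⟩ := hlift hg a.2 (h1 ▸ a'.2)
      exact ⟨h, hh, Subtype.ext ((hgh a).trans h1), Subtype.ext ((hgh b).trans h2)⟩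
  -- every inner pair of `C` is moved into `B`
  have hmove : ∀ a b : {x // x ∈ C}, a ≠ b →
      ∃ g ∈ G, (g (a : P), g (b : P)) ∈ innerOffDiag 𝒞 B := by
    intro a b hab
    have hab' : (a : P) ≠ b := fun h => hab (Subtype.ext h)
    obtain ⟨B', hB'⟩ : (ℬ.filter fun B => (a : P) ∈ B ∧ (b : P) ∈ B).Nonempty := by
      rw [← card_pos, card_blocks_of_ne hdesign hab']; exact hlam
    obtain ⟨hB', ha, hb⟩ := mem_filter.1 hB'
    obtain ⟨g, hg, rfl⟩ := hGtrans B' hB' B hB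
    exact ⟨g, hg, mem_innerOffDiag.2 ⟨⟨mem_image_of_mem _ ha, mem_image_of_mem _ hb,
      g.injective.ne hab'⟩, _, h𝒞inv g hg C hC, mem_image_of_mem _ a.2, mem_image_of_mem _ b.2⟩⟩
  -- distinct inner pairs of `B` lie in distinct orbits
  have hkey : ∀ p ∈ innerOffDiag 𝒞 B, ∀ q ∈ innerOffDiag 𝒞 B,
      (∃ g ∈ G, (g p.1, g p.2) = q) → p = q := by
    intro p hp q hq ⟨g₀, hg₀, hpq⟩
    by_contra hne
    let f : P × P → Set ({x // x ∈ C} × {x // x ∈ C}) := fun t =>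
      {r | ∃ g ∈ G, (g t.1, g t.2) = ((r.1 : P), (r.2 : P))}
    have hf : ∀ t, ∀ g ∈ G, f (g t.1, g t.2) = f t := by
      intro t g hg
      ext r
      constructor
      · rintro ⟨u, hu, h⟩
        exact ⟨u * g, G.mul_mem hu hg, h⟩
      · rintro ⟨u, hu, h⟩
        exact ⟨u * g⁻¹, G.mul_mem hu (G.inv_mem hg), by simpa using h⟩
    have hsub : {O : Set ({x // x ∈ C} × {x // x ∈ C}) |
        ∃ p : {x // x ∈ C} × {x // x ∈ C}, O = {q | ∃ g ∈ H, (g p.1, g p.2) = q}} ⊆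
        ((insert (f (x₀, x₀)) (((innerOffDiag 𝒞 B).erase q).image f) :
          Finset (Set ({x // x ∈ C} × {x // x ∈ C}))) : Set (Set _)) := by
      rintro _ ⟨⟨a, b⟩, rfl⟩
      have hO : {r | ∃ g ∈ H, (g a, g b) = r} = f ((a : P), (b : P)) := by
        ext r; exact horbit (a, b) r
      simp only [hO]
      rw [mem_coe, mem_insert]
      by_cases hab : a = b
      · left
        subst hab
        obtain ⟨g, hg, hga⟩ := htrans x₀ a
        rw [← hga]
        exact hf (x₀, x₀) g hg
      · right
        obtain ⟨g, hg, hgB⟩ := hmove a b hab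
        rw [← hf _ g hg]
        by_cases heq : (g (a : P), g (b : P)) = q
        · refine mem_image.2 ⟨p, mem_erase.2 ⟨hne, hp⟩, ?_⟩
          rw [heq, ← hpq, hf p g₀ hg₀]
        · exact mem_image_of_mem _ (mem_erase.2 ⟨heq, hgB⟩)
    have h1 := Set.ncard_le_ncard hsub (Finset.finite_toSet _)
    rw [Set.ncard_coe_finset] at h1
    have h2 := (h1.trans (card_insert_le _ _)).trans (Nat.add_le_add_right card_image_le 1)
    rw [card_erase_of_mem hq, card_innerOffDiag, hinner B hB] at h2
    have h3 : 2 * n + 1 ≤ 2 * n - 1 + 1 := hrank ▸ h2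
    omega
  constructor
  · by_contra hodd
    rw [Nat.not_odd_iff_even, even_iff_two_dvd] at hodd
    obtain ⟨⟨h, hh⟩, hord⟩ := exists_prime_orderOf_dvd_card' 2 hodd
    rw [Subgroup.orderOf_mk] at hord
    have h1 : h ≠ 1 := by rintro rfl; simp at hord
    obtain ⟨a, ha⟩ : ∃ a, h a ≠ a := by
      by_contra hall
      push Not at hall
      exact h1 (Equiv.ext hall)
    have hha : h (h a) = a := by
      have := pow_orderOf_eq_one h
      rw [hord, sq] at this
      exact DFunLike.congr_fun this a
    obtain ⟨g, hg, hgh⟩ := (hH h).1 hh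
    obtain ⟨u, hu, huB⟩ := hmove a (h a) ha.symm
    have hgg : g (h a) = a := by rw [← hgh, hha]
    have huB' : (u (h a : P), u (a : P)) ∈ innerOffDiag 𝒞 B := by
      obtain ⟨⟨h1, h2, h3⟩, D, hD, h4, h5⟩ := mem_innerOffDiag.1 huB
      exact mem_innerOffDiag.2 ⟨⟨h2, h1, h3.symm⟩, D, hD, h5, h4⟩
    have := hkey _ huB _ huB'
      ⟨u * g * u⁻¹, G.mul_mem (G.mul_mem hu hg) (G.inv_mem hu), by simp [hgg, ← hgh]⟩
    exact ha (Subtype.ext (u.injective (congrArg Prod.snd this)))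
  · intro α β hβα
    let S : Finset (P × P) := univ.filter fun p => ∃ g ∈ G, (g (α : P), g (β : P)) = p
    have hmemS : ∀ p, p ∈ S ↔ ∃ g ∈ G, (g (α : P), g (β : P)) = p := by simp [S]
    have hSinner : ∀ p ∈ S, p ∈ innerOffDiag 𝒞 univ := by
      intro p hp
      obtain ⟨g, hg, rfl⟩ := (hmemS p).1 hp
      exact mem_innerOffDiag.2 ⟨⟨mem_univ _, mem_univ _,
        g.injective.ne fun h => hβα (Subtype.ext h.symm)⟩, _, h𝒞inv g hg C hC,
        mem_image_of_mem _ α.2, mem_image_of_mem _ β.2⟩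
    have hSinv : ∀ g ∈ G, ∀ p ∈ S, (g p.1, g p.2) ∈ S := by
      intro g hg p hp
      obtain ⟨u, hu, rfl⟩ := (hmemS p).1 hp
      exact (hmemS _).2 ⟨g * u, G.mul_mem hg hu, rfl⟩
    have hSB : ∀ B' ∈ ℬ, (S.filter fun p => p.1 ∈ B' ∧ p.2 ∈ B').card = 1 := by
      intro B' hB'
      obtain ⟨g, hg, rfl⟩ := hGtrans B hB B' hB'
      obtain ⟨u, hu, huB⟩ := hmove α β hβα.symm
      refine card_eq_one.2 ⟨(g (u α), g (u β)), ?_⟩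
      have huB1 := (mem_innerOffDiag.1 huB).1
      ext p
      rw [mem_filter, mem_singleton]
      constructor
      · rintro ⟨hp, h1, h2⟩
        obtain ⟨x, hx, hx1⟩ := mem_image.1 h1
        obtain ⟨y, hy, hy1⟩ := mem_image.1 h2
        obtain ⟨w, hw, hwxy⟩ := (hmemS _).1 (show (x, y) ∈ S by
          simpa [← hx1, ← hy1] using hSinv g⁻¹ (G.inv_mem hg) p hp)
        obtain ⟨⟨-, -, hne⟩, hD⟩ := mem_innerOffDiag.1 (hSinner _ ((hmemS (x, y)).2 ⟨w, hw, hwxy⟩))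
        have := hkey _ huB (x, y) (mem_innerOffDiag.2 ⟨⟨hx, hy, hne⟩, hD⟩)
          ⟨w * u⁻¹, G.mul_mem hw (G.inv_mem hu), by simpa using hwxy⟩
        obtain ⟨rfl, rfl⟩ := Prod.mk.inj this
        exact Prod.ext hx1.symm hy1.symm
      · rintro rfl
        exact ⟨(hmemS _).2 ⟨g * u, G.mul_mem hg hu, rfl⟩,
          mem_image_of_mem _ huB1.1, mem_image_of_mem _ huB1.2.1⟩
    have hfib : Set.ncard {γ : {x // x ∈ C} | ∃ h ∈ H, h α = α ∧ h β = γ} =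
        (univ.filter fun y => ((α : P), y) ∈ S).card := by
      rw [← Set.ncard_image_of_injective _ Subtype.val_injective, ← Set.ncard_coe_finset]
      congr 1
      ext y
      simp only [Set.mem_image, Set.mem_ofPred_eq, coe_filter, mem_univ, true_and, hmemS]
      constructor
      · rintro ⟨γ, ⟨h, hh, h1, h2⟩, rfl⟩
        exact (horbit (α, β) (α, γ)).1 ⟨h, hh, by simp [h1, h2]⟩
      · rintro ⟨g, hg, hgy⟩
        obtain ⟨h1, h2⟩ := Prod.mk.inj hgy
        obtain ⟨h, hh, hgh⟩ := hlift hg α.2 (by rw [h1]; exact α.2)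
        exact ⟨h β, ⟨h, hh, Subtype.ext ((hgh α).trans h1), rfl⟩, (hgh β).trans h2⟩
    have hcount := card_pairs_mul_eq hdesign (S := S)
      (fun p hp => (mem_innerOffDiag.1 (hSinner p hp)).1.2.2) hSB
    rw [card_eq_card_mul_fiber htrans hSinv α, ← hfib, mul_one] at hcount
    rw [hinnerCard, ← hcount] at hflags
    have hpos : 0 < Fintype.card P * lam := by
      rw [hP]; positivity
    apply Nat.eq_of_mul_eq_mul_left hpos
    linear_combination -hflags
end

section
/- Let 𝒟 = (𝒫,ℬ) be a 2-(cd,k,λ) design with c ≥ 2, d ≥ 2, let G ≤ Aut(𝒟) be block-transitive leaving invariant a partition 𝒞 of 𝒫 with d classes each of size c, let m, n be the Delandtsheer–Doyen parameters (every block contains exactly n inner pairs and exactly mc outer pairs), and let K = G^𝒞 be the permutation group induced by G on 𝒞. If Rank(K) = 2m + 1, then |K| is odd, and for every class C ∈ 𝒞 every orbit of the stabiliser K_C on 𝒞 \ {C} has size (d−1)/(2m); in particular K is 3/2-transitive on 𝒞. -/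
open Finset

section DoubleCounting

variable {P : Type*} [DecidableEq P]

/-- A block-transitive group makes every invariant set of ordered pairs meet all blocks equally,
so double counting determines the size of the intersection with each block. -/
theorem card_mul_card_filter_block (lam : ℕ) (ℬ : Finset (Finset P))
    (hdesign : ∀ p : Finset P, p.card = 2 → (ℬ.filter fun B => p ⊆ B).card = lam)
    (G : Subgroup (Equiv.Perm P))
    (hGtrans : ∀ B₁ ∈ ℬ, ∀ B₂ ∈ ℬ, ∃ g ∈ G, B₁.image ⇑g = B₂)
    (S : Finset (P × P)) (hne : ∀ p ∈ S, p.1 ≠ p.2)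
    (hinv : ∀ g ∈ G, ∀ p ∈ S, (g p.1, g p.2) ∈ S) (B : Finset P) (hB : B ∈ ℬ) :
    ℬ.card * (S.filter fun p => p.1 ∈ B ∧ p.2 ∈ B).card = lam * S.card := by
  have hle : ∀ B₁ ∈ ℬ, ∀ B₂ ∈ ℬ, (S.filter fun p => p.1 ∈ B₁ ∧ p.2 ∈ B₁).card ≤
      (S.filter fun p => p.1 ∈ B₂ ∧ p.2 ∈ B₂).card := by
    intro B₁ h₁ B₂ h₂
    obtain ⟨g, hg, rfl⟩ := hGtrans B₁ h₁ B₂ h₂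
    refine Finset.card_le_card_of_injOn (fun p => (g p.1, g p.2)) ?_ ?_
    · intro p hp
      simp only [coe_filter, Set.mem_ofPred_eq] at hp ⊢
      exact ⟨hinv g hg p hp.1, mem_image_of_mem _ hp.2.1, mem_image_of_mem _ hp.2.2⟩
    · rintro ⟨a, b⟩ - ⟨a', b'⟩ - h
      simpa using h
  have h1 : ∑ p ∈ S, (ℬ.filter fun B' => p.1 ∈ B' ∧ p.2 ∈ B').card =
      ∑ B' ∈ ℬ, (S.filter fun p => p.1 ∈ B' ∧ p.2 ∈ B').card :=
    Finset.sum_card_bipartiteAbove_eq_sum_card_bipartiteBelow _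
  have h2 : ∀ p ∈ S, (ℬ.filter fun B' => p.1 ∈ B' ∧ p.2 ∈ B').card = lam := by
    intro p hp
    rw [← hdesign {p.1, p.2} (card_pair (hne p hp))]
    simp [insert_subset_iff]
  rw [sum_congr rfl h2, sum_congr rfl (fun B' hB' => le_antisymm (hle B' hB' B hB)
    (hle B hB B' hB'))] at h1
  simp only [sum_const, smul_eq_mul] at h1
  rw [← h1, mul_comm]

/-- Each two-element subset of `B` comes from exactly two ordered pairs. -/
theorem card_filter_offDiag (B : Finset P) (q : Finset P → Prop) [DecidablePred q] :
    (B.offDiag.filter fun p => q {p.1, p.2}).card = 2 * ((B.powersetCard 2).filter q).card := by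
  have hmaps : ∀ p ∈ B.offDiag.filter (fun p => q {p.1, p.2}),
      ({p.1, p.2} : Finset P) ∈ (B.powersetCard 2).filter q := by
    intro p hp
    simp only [mem_filter, mem_offDiag, mem_powersetCard] at hp ⊢
    exact ⟨⟨by simp [insert_subset_iff, hp.1.1, hp.1.2.1], card_pair hp.1.2.2⟩, hp.2⟩
  rw [Finset.card_eq_sum_card_fiberwise hmaps, mul_comm]
  refine Finset.sum_const_nat ?_
  intro s hs
  simp only [mem_filter, mem_powersetCard] at hs
  obtain ⟨⟨hsB, hs2⟩, hq⟩ := hs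
  obtain ⟨x, y, hxy, rfl⟩ := card_eq_two.1 hs2
  have : ((B.offDiag.filter fun p => q {p.1, p.2}).filter
      fun p => ({p.1, p.2} : Finset P) = {x, y}) = {(x, y), (y, x)} := by
    simp only [insert_subset_iff, singleton_subset_iff] at hsB
    ext ⟨a, b⟩
    simp only [mem_filter, mem_offDiag, mem_insert, mem_singleton, Prod.mk.injEq]
    constructor
    · rintro ⟨⟨⟨_, _, hab⟩, _⟩, h⟩
      have ha : a ∈ ({x, y} : Finset P) := h ▸ mem_insert_self _ _
      have hb : b ∈ ({x, y} : Finset P) := h ▸ mem_insert_of_mem (mem_singleton_self _)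
      simp only [mem_insert, mem_singleton] at ha hb
      grind
    · rintro (⟨rfl, rfl⟩ | ⟨rfl, rfl⟩)
      · exact ⟨⟨⟨hsB.1, hsB.2, hxy⟩, hq⟩, rfl⟩
      · exact ⟨⟨⟨hsB.2, hsB.1, hxy.symm⟩, by rwa [pair_comm]⟩, pair_comm _ _⟩
  rw [this, card_pair]
  grind

/-- If a block-transitive group leaves a proper nonempty set of points invariant, then the
design has only the trivial block. -/
theorem block_eq_univ_of_invariant [Fintype P] (lam : ℕ) (hlam : 0 < lam) (ℬ : Finset (Finset P))
    (hdesign : ∀ p : Finset P, p.card = 2 → (ℬ.filter fun B => p ⊆ B).card = lam)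
    (G : Subgroup (Equiv.Perm P))
    (hGtrans : ∀ B₁ ∈ ℬ, ∀ B₂ ∈ ℬ, ∃ g ∈ G, B₁.image ⇑g = B₂)
    (Q : Finset P) (hinv : ∀ g ∈ G, ∀ x, g x ∈ Q ↔ x ∈ Q) (hQ : Q.Nonempty) (hQc : Qᶜ.Nonempty)
    (B : Finset P) (hB : B ∈ ℬ) : B = univ := by
  have key := card_mul_card_filter_block lam ℬ hdesign G hGtrans
  have h1 := key (Q ×ˢ Qᶜ) (by
    rintro ⟨x, y⟩ hp (rfl : x = y)
    simp at hp) (by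
    intro g hg p hp; simpa [hinv g hg] using hp) B hB
  have h2 := key Q.offDiag (by simp) (by
    intro g hg p hp; simpa [hinv g hg] using hp) B hB
  have h3 := key Qᶜ.offDiag (by simp) (by
    intro g hg p hp; simpa [hinv g hg] using hp) B hB
  have e1 : (Q ×ˢ Qᶜ).filter (fun p => p.1 ∈ B ∧ p.2 ∈ B) = (Q ∩ B) ×ˢ (Qᶜ ∩ B) := by
    ext; simp; tauto
  have e2 : ∀ R : Finset P, R.offDiag.filter (fun p => p.1 ∈ B ∧ p.2 ∈ B) = (R ∩ B).offDiag := by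
    intro R; ext; simp; tauto
  rw [e1, card_product, card_product] at h1
  rw [e2, offDiag_card, offDiag_card, ← Nat.mul_sub_one, ← Nat.mul_sub_one] at h2 h3
  have hsum : (Q ∩ B).card + (Qᶜ ∩ B).card = B.card := by
    rw [inter_comm Q, inter_comm Qᶜ, ← sdiff_eq_inter_compl, card_inter_add_card_sdiff]
  have hv : Q.card + Qᶜ.card = Fintype.card P := card_add_card_compl Q
  have hq := hQ.card_pos
  have hp := hQc.card_pos
  rw [← card_eq_iff_eq_univ, ← hsum, ← hv]
  clear hsum hv e1 e2 key
  generalize Q.card = q at *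
  generalize Qᶜ.card = p at *
  generalize (Q ∩ B).card = x at *
  generalize (Qᶜ ∩ B).card = y at *
  generalize ℬ.card = b at *
  have hpos : 0 < b * (x * y) := by rw [h1]; positivity
  have hx : 0 < x := by exact Nat.pos_of_ne_zero (by rintro rfl; simp at hpos)
  have hy : 0 < y := by exact Nat.pos_of_ne_zero (by rintro rfl; simp at hpos)
  obtain ⟨x, rfl⟩ : ∃ z, x = z + 1 := ⟨x - 1, by omega⟩
  obtain ⟨y, rfl⟩ : ∃ z, y = z + 1 := ⟨y - 1, by omega⟩
  obtain ⟨q, rfl⟩ : ∃ z, q = z + 1 := ⟨q - 1, by omega⟩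
  obtain ⟨p, rfl⟩ : ∃ z, p = z + 1 := ⟨p - 1, by omega⟩
  simp only [Nat.add_sub_cancel] at h2 h3
  have a1 : q * (y + 1) = (p + 1) * x := by
    have : lam * (q + 1) * (q * (y + 1)) = lam * (q + 1) * ((p + 1) * x) := by
      have e2 := congrArg (· * (y + 1)) h2
      have e1 := congrArg (x * ·) h1
      linarith
    exact Nat.eq_of_mul_eq_mul_left (by positivity) this
  have a2 : p * (x + 1) = (q + 1) * y := by
    have : lam * (p + 1) * (p * (x + 1)) = lam * (p + 1) * ((q + 1) * y) := by
      have e2 := congrArg (· * (x + 1)) h3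
      have e1 := congrArg (y * ·) h1
      linarith
    exact Nat.eq_of_mul_eq_mul_left (by positivity) this
  nlinarith

end DoubleCounting

/-- A finite set of pairs closed under swapping and missing the diagonal has even cardinality. -/
theorem even_card_of_swap_mem {P : Type*} (F : Finset (P × P)) (hne : ∀ p ∈ F, p.1 ≠ p.2)
    (hswap : ∀ p ∈ F, p.swap ∈ F) : Even F.card := by
  have h : ∑ _p ∈ F, (1 : ZMod 2) = 0 :=
    Finset.sum_involution (fun p _ => p.swap) (fun _ _ => by decide)
      (fun p hp _ h => hne p hp (congrArg Prod.snd h)) hswap (fun p _ => p.swap_swap)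
  rw [even_iff_two_dvd, ← ZMod.natCast_eq_zero_iff]
  simpa using h

/-- If all fibres of `f` have `c` elements, the preimage of a set of pairs under `f × f` has
`c²` times as many elements. -/
theorem card_filter_prodMap_mem {P Ω : Type*} [Fintype P] [DecidableEq Ω] (f : P → Ω) (c : ℕ)
    (hf : ∀ D, (univ.filter fun x => f x = D).card = c) (T : Finset (Ω × Ω)) :
    (univ.filter fun p : P × P => (f p.1, f p.2) ∈ T).card = T.card * (c * c) := by
  rw [Finset.card_eq_sum_card_fiberwise (f := fun p : P × P => (f p.1, f p.2)) (t := T)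
    (by intro p hp; simpa using hp)]
  refine Finset.sum_const_nat ?_
  rintro ⟨C, D⟩ hT
  calc _ = ((univ.filter fun x => f x = C) ×ˢ (univ.filter fun x => f x = D)).card := by
        congr 1
        ext ⟨x, y⟩
        simp only [mem_filter, mem_univ, true_and, Prod.mk.injEq, mem_product]
        constructor
        · exact fun h => h.2
        · rintro ⟨rfl, rfl⟩
          exact ⟨hT, rfl, rfl⟩
    _ = c * c := by rw [card_product, hf, hf]


section PairOrbits

variable {Ω : Type*}

/-- The orbit of an ordered pair under a permutation group. -/
def pairOrbit (X : Subgroup (Equiv.Perm Ω)) (p : Ω × Ω) : Set (Ω × Ω) :=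
  {q | ∃ g ∈ X, (g p.1, g p.2) = q}

theorem mem_pairOrbit_self (X : Subgroup (Equiv.Perm Ω)) (p : Ω × Ω) : p ∈ pairOrbit X p :=
  ⟨1, X.one_mem, rfl⟩

theorem pairOrbit_map (X : Subgroup (Equiv.Perm Ω)) (g : Equiv.Perm Ω) (hg : g ∈ X) (a b : Ω) :
    pairOrbit X (g a, g b) = pairOrbit X (a, b) := by
  ext q
  constructor
  · rintro ⟨h, hh, rfl⟩
    exact ⟨h * g, X.mul_mem hh hg, rfl⟩
  · rintro ⟨h, hh, rfl⟩
    exact ⟨h * g⁻¹, X.mul_mem hh (X.inv_mem hg), by simp⟩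

theorem pairOrbit_eq_iff (X : Subgroup (Equiv.Perm Ω)) (a b a' b' : Ω) :
    pairOrbit X (a', b') = pairOrbit X (a, b) ↔ ∃ g ∈ X, g a = a' ∧ g b = b' := by
  constructor
  · intro h
    obtain ⟨g, hg, hq⟩ : (a', b') ∈ pairOrbit X (a, b) := h ▸ mem_pairOrbit_self X (a', b')
    exact ⟨g, hg, congrArg Prod.fst hq, congrArg Prod.snd hq⟩
  · rintro ⟨g, hg, rfl, rfl⟩
    exact pairOrbit_map X g hg a b

open Classical in
theorem permRank_eq_card_image [Fintype Ω] (X : Subgroup (Equiv.Perm Ω)) :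
    permRank X = (univ.image (pairOrbit X)).card := by
  have : {O : Set (Ω × Ω) | ∃ p : Ω × Ω, O = pairOrbit X p} =
      ((univ.image (pairOrbit X) : Finset (Set (Ω × Ω))) : Set (Set (Ω × Ω))) := by
    ext O
    simp [eq_comm]
  rw [← Set.ncard_coe_finset, ← this]
  rfl

open Classical in
/-- In a transitive group, an orbital is `|Ω|` times as large as its suborbits. -/
theorem card_pairOrbit_eq [Fintype Ω] (X : Subgroup (Equiv.Perm Ω))
    (htrans : ∀ C D, ∃ g ∈ X, g C = D) (C D : Ω) :
    (univ.filter fun p => pairOrbit X p = pairOrbit X (C, D)).card =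
      Fintype.card Ω * Set.ncard {E : Ω | ∃ g ∈ X, g C = C ∧ g D = E} := by
  have hs : {E : Ω | ∃ g ∈ X, g C = C ∧ g D = E} =
      ((univ.filter fun E => pairOrbit X (C, E) = pairOrbit X (C, D) : Finset Ω) : Set Ω) := by
    ext E
    simp [pairOrbit_eq_iff]
  rw [hs, Set.ncard_coe_finset, Finset.card_eq_sum_card_fiberwise (f := Prod.fst) (t := univ)
    (by simp), ← card_univ]
  refine Finset.sum_const_nat ?_
  intro A _
  obtain ⟨g, hg, rfl⟩ := htrans C A
  rw [← card_image_of_injective (univ.filter fun E => pairOrbit X (C, E) = pairOrbit X (C, D))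
    (f := fun E => (g C, g E)) (fun E E' h => by simpa using h)]
  congr 1
  ext ⟨A, E⟩
  simp only [mem_filter, mem_univ, true_and, mem_image, Prod.mk.injEq]
  constructor
  · rintro ⟨h, rfl⟩
    refine ⟨g⁻¹ E, ?_, rfl, by simp⟩
    rw [← h, ← pairOrbit_map X g hg]
    simp
  · rintro ⟨E, h, rfl, rfl⟩
    exact ⟨by rw [pairOrbit_map X g hg, h], rfl⟩

end PairOrbits

open Classical in
/-- The extremal case of the rank bound, for a partition given as the fibres of a map `cl` and
pairs counted as ordered pairs: every orbital then meets a block in exactly `c` pairs. -/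
theorem odd_card_and_suborbits_of_permRank_eq {P Ω : Type*} [Fintype P] [Fintype Ω]
    (c d lam m n : ℕ) (hc : 2 ≤ c) (hd : 2 ≤ d) (hlam : 0 < lam)
    (hP : Fintype.card P = c * d) (hΩ : Fintype.card Ω = d)
    (ℬ : Finset (Finset P))
    (hdesign : ∀ p : Finset P, p.card = 2 → (ℬ.filter fun B => p ⊆ B).card = lam)
    (G : Subgroup (Equiv.Perm P))
    (hGtrans : ∀ B₁ ∈ ℬ, ∀ B₂ ∈ ℬ, ∃ g ∈ G, B₁.image ⇑g = B₂)
    (cl : P → Ω) (hcl : ∀ D, (univ.filter fun x => cl x = D).card = c)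
    (hinner : ∀ B ∈ ℬ, (B.offDiag.filter fun p => cl p.1 = cl p.2).card = 2 * n)
    (houter : ∀ B ∈ ℬ, (B.offDiag.filter fun p => ¬ cl p.1 = cl p.2).card = 2 * (m * c))
    (K : Subgroup (Equiv.Perm Ω))
    (hGK : ∀ g ∈ G, ∃ κ ∈ K, ∀ x, cl (g x) = κ (cl x))
    (hrank : permRank K = 2 * m + 1) :
    Odd (Nat.card K) ∧ ∀ C D : Ω, D ≠ C →
      2 * m * Set.ncard {E : Ω | ∃ κ ∈ K, κ C = C ∧ κ D = E} = d - 1 := by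
  have hsurj : ∀ D, ∃ x, cl x = D := by
    intro D
    obtain ⟨x, hx⟩ := card_pos.1 (by rw [hcl D]; omega)
    exact ⟨x, by simpa using hx⟩
  have : Nontrivial Ω := Fintype.one_lt_card_iff_nontrivial.1 (by omega)
  obtain ⟨C₀, D₀, hCD₀⟩ := exists_pair_ne Ω
  obtain ⟨x₀, hx₀⟩ := hsurj C₀
  obtain ⟨y₀, hy₀⟩ := hsurj D₀
  obtain ⟨B, hB⟩ : ℬ.Nonempty := by
    have h := hdesign {x₀, y₀} (card_pair (by rintro rfl; exact hCD₀ (hx₀.symm.trans hy₀)))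
    obtain ⟨B, hB⟩ := card_pos.1 (h ▸ hlam)
    exact ⟨B, (mem_filter.1 hB).1⟩
  have hb : 0 < ℬ.card := card_pos.2 ⟨B, hB⟩
  have key : ∀ S : Finset (P × P), _ := card_mul_card_filter_block lam ℬ hdesign G hGtrans
  -- the number of ordered pairs of points in a prescribed `G`-invariant set of class pairs
  have hclass : ∀ T : Finset (Ω × Ω), (∀ p ∈ T, p.1 ≠ p.2) →
      (∀ κ ∈ K, ∀ p ∈ T, (κ p.1, κ p.2) ∈ T) →
      ℬ.card * (B.offDiag.filter fun p => (cl p.1, cl p.2) ∈ T).card =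
        lam * (T.card * (c * c)) := by
    intro T hT hinv
    have h := key (univ.filter fun p : P × P => (cl p.1, cl p.2) ∈ T)
      (fun p hp h => hT _ (mem_filter.1 hp).2 (congrArg cl h))
      (fun g hg p hp => by
        obtain ⟨κ, hκ, hgκ⟩ := hGK g hg
        simp only [mem_filter, mem_univ, true_and, hgκ] at hp ⊢
        exact hinv κ hκ _ hp) B hB
    rw [card_filter_prodMap_mem cl c hcl] at h
    rw [← h]
    congr 2
    ext p
    simp only [mem_filter, mem_offDiag, mem_univ, true_and]
    constructor
    · exact fun h => ⟨h.2, h.1.1, h.1.2.1⟩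
    · exact fun h => ⟨⟨h.2.1, h.2.2, fun e => hT _ h.1 (congrArg cl e)⟩, h.1⟩
  have hout : ℬ.card * (2 * (m * c)) = lam * (d * (d - 1) * (c * c)) := by
    have h := hclass univ.offDiag (by simp) (by simp)
    rw [offDiag_card, card_univ, hΩ, ← Nat.mul_sub_one] at h
    rw [← h, ← houter B hB]
    simp
  have htot : ℬ.card * (2 * (m * c) + 2 * n) = lam * (c * d * (c * d - 1)) := by
    have h := key univ.offDiag (by simp) (by simp) B hB
    rw [offDiag_card, card_univ, hP, ← Nat.mul_sub_one] at h
    rw [← h, ← houter B hB, ← hinner B hB, add_comm, card_filter_add_card_filter_not]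
    congr 2
    ext p
    simp
    tauto
  have hin : ℬ.card * (2 * n) = lam * (d * (c * (c - 1))) := by
    obtain ⟨e, rfl⟩ : ∃ e, c = e + 1 := ⟨c - 1, by omega⟩
    obtain ⟨f, rfl⟩ : ∃ f, d = f + 1 := ⟨d - 1, by omega⟩
    have : (e + 1) * (f + 1) - 1 = e * f + e + f := by
      rw [Nat.sub_eq_iff_eq_add (by nlinarith)]; ring
    rw [this] at htot
    simp only [Nat.add_sub_cancel] at *
    linarith
  have hc0 : 0 < c := by omega
  have hd0 : 0 < d := by omega
  have hratio : n * (d - 1) = m * (c - 1) := by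
    have : lam * d * c * c * (n * (d - 1)) = lam * d * c * c * (m * (c - 1)) := by
      have e1 := congrArg (n * ·) hout
      have e2 := congrArg (m * c * ·) hin
      linarith
    exact Nat.eq_of_mul_eq_mul_left (by positivity) this
  have hBuniv : B ≠ univ := by
    rintro rfl
    have hb1 : 2 * m = d * (d - 1) * c := by
      have h : 2 * (m * c) = d * (d - 1) * (c * c) := by
        rw [← houter univ hB]
        have h := card_filter_prodMap_mem cl c hcl univ.offDiag
        rw [offDiag_card, card_univ, hΩ, ← Nat.mul_sub_one] at h
        rw [← h]
        congr 1
        ext p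
        simp only [mem_filter, mem_offDiag, mem_univ, true_and, and_iff_right_iff_imp]
        exact fun h e => h (congrArg cl e)
      exact Nat.eq_of_mul_eq_mul_right hc0 (by linarith)
    have hle : permRank K ≤ d * d := by
      rw [permRank_eq_card_image]
      refine card_image_le.trans ?_
      rw [card_univ, Fintype.card_prod, hΩ]
    rw [hrank, hb1] at hle
    obtain ⟨f, rfl⟩ : ∃ f, d = f + 2 := ⟨d - 2, by omega⟩
    have : (f + 2) * (f + 2 - 1) * 2 ≤ (f + 2) * (f + 2 - 1) * c := Nat.mul_le_mul_left _ hc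
    have e : f + 2 - 1 = f + 1 := rfl
    rw [e] at this hle
    nlinarith
  have htrans : ∀ C D, ∃ κ ∈ K, κ C = D := by
    intro C D
    by_contra hD
    refine hBuniv (block_eq_univ_of_invariant lam hlam ℬ hdesign G hGtrans
      (univ.filter fun x => ∃ κ ∈ K, κ C = cl x) ?_ ?_ ?_ B hB)
    · intro g hg x
      obtain ⟨κ, hκ, hgκ⟩ := hGK g hg
      simp only [mem_filter, mem_univ, true_and, hgκ]
      constructor
      · rintro ⟨κ', hκ', h⟩
        exact ⟨κ⁻¹ * κ', K.mul_mem (K.inv_mem hκ) hκ', by simp [h]⟩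
      · rintro ⟨κ', hκ', h⟩
        exact ⟨κ * κ', K.mul_mem hκ hκ', by simp [h]⟩
    · obtain ⟨x, hx⟩ := hsurj C
      exact ⟨x, by simpa using ⟨1, K.one_mem, hx.symm⟩⟩
    · obtain ⟨x, hx⟩ := hsurj D
      exact ⟨x, by simpa [hx] using hD⟩
  -- the numbers of pairs of `B` lying over the orbitals of `K`
  have hM : ∀ C D : Ω, D ≠ C →
      (B.offDiag.filter fun p =>
        pairOrbit K (cl p.1, cl p.2) = pairOrbit K (C, D)).card * (c - 1) =
        c * (2 * n * Set.ncard {E : Ω | ∃ κ ∈ K, κ C = C ∧ κ D = E}) ∧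
      0 < (B.offDiag.filter fun p =>
        pairOrbit K (cl p.1, cl p.2) = pairOrbit K (C, D)).card := by
    intro C D hCD
    have h := hclass (univ.filter fun p => pairOrbit K p = pairOrbit K (C, D)) (by
      rintro ⟨A, E⟩ hp (rfl : A = E)
      obtain ⟨κ, _, h1, h2⟩ := (pairOrbit_eq_iff K C D A A).1 (mem_filter.1 hp).2
      exact hCD (κ.injective (h2.trans h1.symm))) (by
      rintro κ hκ ⟨A, E⟩ hp
      simpa [pairOrbit_map K κ hκ] using hp)
    rw [card_pairOrbit_eq K htrans, hΩ] at h
    simp only [mem_filter, mem_univ, true_and] at h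
    have hs : 0 < Set.ncard {E : Ω | ∃ κ ∈ K, κ C = C ∧ κ D = E} :=
      (Set.ncard_pos (Set.toFinite _)).2 ⟨D, 1, K.one_mem, rfl, rfl⟩
    generalize (B.offDiag.filter fun p =>
        pairOrbit K (cl p.1, cl p.2) = pairOrbit K (C, D)).card = M at *
    generalize Set.ncard {E : Ω | ∃ κ ∈ K, κ C = C ∧ κ D = E} = s at *
    have hpos : 0 < ℬ.card * M := by rw [h]; positivity
    refine ⟨?_, Nat.pos_of_mul_pos_left hpos⟩
    have : lam * d * c * (M * (c - 1)) = lam * d * c * (c * (2 * n * s)) := by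
      have e1 := congrArg (M * ·) hin
      have e2 := congrArg (2 * n * ·) h
      linarith
    exact Nat.eq_of_mul_eq_mul_left (by positivity) this
  have hMle : ∀ C D : Ω, D ≠ C → c ≤ (B.offDiag.filter fun p =>
      pairOrbit K (cl p.1, cl p.2) = pairOrbit K (C, D)).card := by
    intro C D hCD
    obtain ⟨h1, h2⟩ := hM C D hCD
    have hcop : Nat.Coprime c (c - 1) := by
      rw [Nat.coprime_self_sub_right hc0]
      exact Nat.coprime_one_right c
    exact Nat.le_of_dvd h2 (hcop.dvd_of_dvd_mul_right (Dvd.intro _ h1.symm))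
  set R : Finset (Set (Ω × Ω)) := (univ.image (pairOrbit K)).erase (pairOrbit K (C₀, C₀)) with hR
  have hRcard : R.card = 2 * m := by
    rw [hR, card_erase_of_mem (mem_image_of_mem _ (mem_univ _)), ← permRank_eq_card_image, hrank]
    rfl
  have hRmem : ∀ C D : Ω, pairOrbit K (C, D) ∈ R ↔ D ≠ C := by
    intro C D
    simp only [hR, mem_erase, mem_image_of_mem _ (mem_univ _), and_true, ne_eq, not_iff_not,
      pairOrbit_eq_iff]
    constructor
    · rintro ⟨κ, _, rfl, rfl⟩
      rfl
    · rintro rfl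
      obtain ⟨κ, hκ, h⟩ := htrans C₀ D
      exact ⟨κ, hκ, h, h⟩
  have hMeq : ∀ C D : Ω, D ≠ C → (B.offDiag.filter fun p =>
      pairOrbit K (cl p.1, cl p.2) = pairOrbit K (C, D)).card = c := by
    have hsum : ∑ O ∈ R, (B.offDiag.filter fun p => pairOrbit K (cl p.1, cl p.2) = O).card =
        ∑ _O ∈ R, c := by
      rw [sum_const, hRcard, smul_eq_mul, mul_assoc, ← houter B hB,
        Finset.card_eq_sum_card_fiberwise (f := fun p => pairOrbit K (cl p.1, cl p.2)) (t := R)]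
      · refine sum_congr rfl fun O hO => ?_
        congr 1
        ext p
        simp only [mem_filter]
        constructor
        · rintro ⟨hp, rfl⟩
          exact ⟨⟨hp, ((hRmem _ _).1 hO).symm⟩, rfl⟩
        · exact fun h => ⟨h.1.1, h.2⟩
      · intro p hp
        exact (hRmem _ _).2 (Ne.symm (mem_filter.1 hp).2)
    intro C D hCD
    refine ((sum_eq_sum_iff_of_le ?_).1 hsum.symm _ ((hRmem C D).2 hCD)).symm
    intro O hO
    obtain ⟨⟨A, E⟩, -, rfl⟩ := mem_image.1 (mem_of_mem_erase hO)
    exact hMle A E ((hRmem A E).1 hO)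
  have hs : ∀ C D : Ω, D ≠ C →
      c - 1 = 2 * n * Set.ncard {E : Ω | ∃ κ ∈ K, κ C = C ∧ κ D = E} := by
    intro C D hCD
    have h := (hM C D hCD).1
    rw [hMeq C D hCD] at h
    exact Nat.eq_of_mul_eq_mul_left hc0 h
  constructor
  · rw [← Nat.not_even_iff_odd, even_iff_two_dvd]
    intro h2
    have : Fact (Nat.Prime 2) := ⟨Nat.prime_two⟩
    obtain ⟨⟨κ, hκ⟩, hord⟩ := exists_prime_orderOf_dvd_card' (G := K) 2 h2
    rw [Subgroup.orderOf_mk] at hord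
    obtain ⟨hsq, hne⟩ := orderOf_eq_prime_iff.1 hord
    obtain ⟨C, hC⟩ : ∃ C, κ C ≠ C := by
      by_contra! h
      exact hne (Equiv.ext h)
    have hκκ : κ (κ C) = C := by
      rw [← Equiv.Perm.mul_apply, ← pow_two, hsq, Equiv.Perm.one_apply]
    have heven : Even c := by
      rw [← hMeq C (κ C) hC]
      refine even_card_of_swap_mem _ (by simp +contextual) ?_
      rintro ⟨x, y⟩ hp
      simp only [mem_filter, mem_offDiag, Prod.swap_prod_mk] at hp ⊢
      refine ⟨⟨hp.1.2.1, hp.1.1, hp.1.2.2.symm⟩, ?_⟩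
      obtain ⟨g, hg, h1, h2⟩ := (pairOrbit_eq_iff _ _ _ _ _).1 hp.2
      exact (pairOrbit_eq_iff _ _ _ _ _).2 ⟨g * κ, K.mul_mem hg hκ, by simp [h2], by
        simp [hκκ, h1]⟩
    have h := hs C (κ C) hC
    obtain ⟨e, he⟩ := heven
    rw [mul_assoc] at h
    omega
  · intro C D hCD
    have h := hs C D hCD
    have hn : 0 < n := by
      refine Nat.pos_of_ne_zero ?_
      rintro rfl
      simp at h
      omega
    rw [h] at hratio
    exact Nat.eq_of_mul_eq_mul_left hn (by linarith)

/-- If `Rank(K) = 2m + 1` (the maximum possible), then `|K|` is odd and every orbit of a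
class stabiliser `K_C` on `𝒞 \ {C}` has size `(d−1)/(2m)`; in particular `K` is
`3/2`-transitive on `𝒞`. -/
theorem max_rank_K
    {P : Type*} [Fintype P] [DecidableEq P]
    (c d k lam m n : ℕ) (hc : 2 ≤ c) (hd : 2 ≤ d) (hlam : 0 < lam)
    (hP : Fintype.card P = c * d)
    (ℬ : Finset (Finset P))
    (hblocksize : ∀ B ∈ ℬ, B.card = k)
    (hdesign : ∀ p : Finset P, p.card = 2 → (ℬ.filter fun B => p ⊆ B).card = lam)
    (G : Subgroup (Equiv.Perm P))
    (hGaut : ∀ g ∈ G, ∀ B ∈ ℬ, B.image ⇑g ∈ ℬ)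
    (hGtrans : ∀ B₁ ∈ ℬ, ∀ B₂ ∈ ℬ, ∃ g ∈ G, B₁.image ⇑g = B₂)
    (𝒞 : Finset (Finset P))
    (h𝒞d : 𝒞.card = d) (h𝒞c : ∀ C ∈ 𝒞, C.card = c)
    (h𝒞part : ∀ x : P, ∃! C, C ∈ 𝒞 ∧ x ∈ C)
    (h𝒞inv : ∀ g ∈ G, ∀ C ∈ 𝒞, C.image ⇑g ∈ 𝒞)
    (hm : 0 < m) (hn : 0 < n)
    (hinner : ∀ B ∈ ℬ, innerPairs 𝒞 B = n)
    (houter : ∀ B ∈ ℬ, outerPairs 𝒞 B = m * c)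
    (K : Subgroup (Equiv.Perm {D // D ∈ 𝒞}))
    (hK : ∀ κ : Equiv.Perm {D // D ∈ 𝒞},
      κ ∈ K ↔ ∃ g ∈ G, ∀ D : {D // D ∈ 𝒞}, (↑(κ D) : Finset P) = (↑D : Finset P).image ⇑g)
    (hrank : permRank K = 2 * m + 1) :
    Odd (Nat.card K) ∧
    ∀ C' D' : {D // D ∈ 𝒞}, D' ≠ C' →
      2 * m * Set.ncard {E : {D // D ∈ 𝒞} | ∃ κ ∈ K, κ C' = C' ∧ κ D' = E} = d - 1 := by
  choose f hf hfuniq using h𝒞part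
  simp only [and_imp] at hf hfuniq
  let cl : P → {D // D ∈ 𝒞} := fun x => ⟨f x, (hf x).1⟩
  have hcl : ∀ x D, cl x = D ↔ x ∈ D.1 := by
    intro x D
    constructor
    · rintro rfl
      exact (hf x).2
    · exact fun h => Subtype.ext (hfuniq x D.1 D.2 h).symm
  have hpair : ∀ x y, cl x = cl y ↔ ∃ C ∈ 𝒞, {x, y} ⊆ C := by
    intro x y
    simp only [insert_subset_iff, singleton_subset_iff]
    constructor
    · exact fun h => ⟨(cl x).1, (cl x).2, (hcl _ _).1 rfl, (hcl _ _).1 h.symm⟩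
    · rintro ⟨C, hC, hx, hy⟩
      exact ((hcl x ⟨C, hC⟩).2 hx).trans ((hcl y ⟨C, hC⟩).2 hy).symm
  convert odd_card_and_suborbits_of_permRank_eq c d lam m n hc hd hlam hP
    (by rw [Fintype.card_coe, h𝒞d]) ℬ ?_ G ?_ cl ?_ ?_ ?_ K ?_ hrank
  · intro p hp
    convert hdesign p hp
  · intro B₁ h₁ B₂ h₂
    convert hGtrans B₁ h₁ B₂ h₂
  · intro D
    rw [← h𝒞c D.1 D.2]
    congr 1
    ext x
    simp [hcl]
  · intro B hB
    rw [← hinner B hB, innerPairs, ← card_filter_offDiag]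
    simp only [hpair]
  · intro B hB
    rw [← houter B hB, outerPairs, ← card_filter_offDiag]
    simp only [hpair]
  · intro g hg
    let φ : {D // D ∈ 𝒞} → {D // D ∈ 𝒞} := fun D => ⟨D.1.image g, h𝒞inv g hg D.1 D.2⟩
    have hφ : Function.Injective φ := fun D E h =>
      Subtype.ext (image_injective g.injective (congrArg Subtype.val h))
    refine ⟨Equiv.ofBijective φ (Finite.injective_iff_bijective.1 hφ),
      (hK _).2 ⟨g, hg, fun D => rfl⟩, fun x => (hcl _ _).2 ?_⟩
    exact mem_image_of_mem g ((hcl x _).1 rfl)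
end

section
/- Let 𝒟 = (𝒫,ℬ) be a 2-(cd,k,λ) design with c ≥ 2, d ≥ 2, let G ≤ Aut(𝒟) be block-transitive leaving invariant a partition 𝒞 of 𝒫 with d classes each of size c, and let m, n be the Delandtsheer–Doyen parameters (every block contains exactly n inner pairs and exactly mc outer pairs). If cd − 1 = k(k−1), then n = (c−1)/2 and m = (d−1)/2. If moreover G is cyclic of order cd and acts regularly on 𝒫, then the induced groups H = G_C^C (on a class C) and K = G^𝒞 (on 𝒞) satisfy Rank(H) = c = 2n + 1 and Rank(K) = d = 2m + 1. -/
open Finset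

/-- In a 2-design, counting incident pairs (pair in `S`, block) in two ways. -/
theorem sum_card_filter_powersetCard_two {P : Type*} [DecidableEq P] {ℬ : Finset (Finset P)}
    {lam : ℕ}
    (hdesign : ∀ p : Finset P, p.card = 2 → (ℬ.filter fun B => p ⊆ B).card = lam)
    (S : Finset (Finset P)) (hS : ∀ p ∈ S, p.card = 2) :
    ∑ B ∈ ℬ, ((B.powersetCard 2).filter (· ∈ S)).card = lam * S.card := by
  have h := Finset.sum_card_bipartiteAbove_eq_sum_card_bipartiteBelow
    (s := S) (t := ℬ) (fun p B => p ⊆ B)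
  have h1 : ∑ p ∈ S, (ℬ.bipartiteAbove (fun p B => p ⊆ B) p).card = lam * S.card := by
    rw [Finset.sum_congr rfl fun p hp =>
      show (ℬ.bipartiteAbove (fun p B => p ⊆ B) p).card = lam from hdesign p (hS p hp),
      Finset.sum_const, smul_eq_mul, mul_comm]
  rw [← h1, h]
  refine Finset.sum_congr rfl fun B _ => congrArg Finset.card ?_
  ext p
  simp only [Finset.mem_filter, Finset.mem_powersetCard, Finset.bipartiteBelow]
  exact ⟨fun hp => ⟨hp.2, hp.1.1⟩, fun hp => ⟨⟨hp.2, hS p hp.1⟩, hp.1⟩⟩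

/-- The number of 2-subsets lying inside a class of a partition into `d` classes of size `c`. -/
theorem card_biUnion_powersetCard_two {P : Type*} [DecidableEq P] {𝒞 : Finset (Finset P)}
    {c d : ℕ} (h𝒞d : 𝒞.card = d) (h𝒞c : ∀ C ∈ 𝒞, C.card = c)
    (h𝒞part : ∀ x : P, ∃! C, C ∈ 𝒞 ∧ x ∈ C) :
    (𝒞.biUnion (Finset.powersetCard 2)).card = d * c.choose 2 := by
  rw [Finset.card_biUnion]
  · rw [Finset.sum_congr rfl fun C hC => by rw [Finset.card_powersetCard, h𝒞c C hC],
      Finset.sum_const, smul_eq_mul, h𝒞d]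
  · intro C hC D hD hne
    refine Finset.disjoint_left.2 ?_
    intro p hpC hpD
    rw [Finset.mem_powersetCard] at hpC hpD
    obtain ⟨x, hx⟩ : p.Nonempty := Finset.card_pos.1 (by omega)
    exact hne ((h𝒞part x).unique ⟨hC, hpC.1 hx⟩ ⟨hD, hpD.1 hx⟩)

/-- `innerPairs` and `outerPairs` together count all pairs. -/
theorem innerPairs_add_outerPairs {P : Type*} [DecidableEq P] (𝒞 : Finset (Finset P))
    (B : Finset P) : innerPairs 𝒞 B + outerPairs 𝒞 B = B.card.choose 2 := by
  rw [innerPairs, outerPairs, Finset.card_filter_add_card_filter_not, Finset.card_powersetCard]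

/-- The rank of a regular permutation group is its degree. -/
theorem permRank_eq_card_of_regular {Ω : Type*} [Nonempty Ω] (X : Subgroup (Equiv.Perm Ω))
    (htrans : ∀ x y : Ω, ∃ g ∈ X, g x = y)
    (hfree : ∀ g ∈ X, (∃ x : Ω, g x = x) → g = 1) :
    permRank X = Nat.card Ω := by
  obtain ⟨ω⟩ := ‹Nonempty Ω›
  refine (Nat.card_eq_of_bijective (fun y : Ω =>
    (⟨{q | ∃ g ∈ X, (g ω, g y) = q}, (ω, y), rfl⟩ :
      {O : Set (Ω × Ω) // ∃ p : Ω × Ω, O = {q | ∃ g ∈ X, (g p.1, g p.2) = q}})) ⟨?_, ?_⟩).symm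
  · intro y z hyz
    have hmem : (ω, z) ∈ {q : Ω × Ω | ∃ g ∈ X, (g ω, g y) = q} := by
      rw [Subtype.mk.injEq] at hyz
      rw [hyz]
      exact ⟨1, X.one_mem, rfl⟩
    obtain ⟨g, hg, hgq⟩ := hmem
    rw [Prod.mk.injEq] at hgq
    have h1 := hfree g hg ⟨ω, hgq.1⟩
    simpa [h1] using hgq.2
  · rintro ⟨_, ⟨x, y⟩, rfl⟩
    obtain ⟨h, hh, rfl⟩ := htrans ω x
    refine ⟨h⁻¹ y, Subtype.ext ?_⟩
    ext q
    constructor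
    · rintro ⟨g, hg, rfl⟩
      exact ⟨g * h⁻¹, X.mul_mem hg (X.inv_mem hh), by simp⟩
    · rintro ⟨g, hg, rfl⟩
      exact ⟨g * h, X.mul_mem hg hh, by simp⟩

/-- The numerical part: `n = (c - 1) / 2` and `m = (d - 1) / 2`. -/
theorem delandtsheer_doyen_parameters
    {P : Type*} [Fintype P] [DecidableEq P]
    {c d k lam m n : ℕ} (hc : 2 ≤ c) (hd : 2 ≤ d) (hlam : 0 < lam)
    (hP : Fintype.card P = c * d) {ℬ : Finset (Finset P)}
    (hblocksize : ∀ B ∈ ℬ, B.card = k)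
    (hdesign : ∀ p : Finset P, p.card = 2 → (ℬ.filter fun B => p ⊆ B).card = lam)
    {𝒞 : Finset (Finset P)}
    (h𝒞d : 𝒞.card = d) (h𝒞c : ∀ C ∈ 𝒞, C.card = c)
    (h𝒞part : ∀ x : P, ∃! C, C ∈ 𝒞 ∧ x ∈ C)
    (hinner : ∀ B ∈ ℬ, innerPairs 𝒞 B = n)
    (houter : ∀ B ∈ ℬ, outerPairs 𝒞 B = m * c)
    (hcd : c * d - 1 = k * (k - 1)) :
    2 * n = c - 1 ∧ 2 * m = d - 1 := by
  have hv : 4 ≤ c * d := Nat.mul_le_mul hc hd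
  have htotal : ℬ.card * k.choose 2 = lam * (c * d).choose 2 := by
    have h := sum_card_filter_powersetCard_two hdesign (Finset.univ.powersetCard 2)
      fun p hp => (Finset.mem_powersetCard.1 hp).2
    rw [Finset.card_powersetCard, Finset.card_univ, hP] at h
    rw [← h, ← smul_eq_mul, ← Finset.sum_const]
    refine Finset.sum_congr rfl fun B hB => ?_
    rw [Finset.filter_true_of_mem fun p hp => by
      simpa using (Finset.mem_powersetCard.1 hp).2, Finset.card_powersetCard, hblocksize B hB]
  have hin : ℬ.card * n = lam * (d * c.choose 2) := by
    have h := sum_card_filter_powersetCard_two hdesign (𝒞.biUnion (Finset.powersetCard 2))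
      fun p hp => by
        obtain ⟨C, _, hpC⟩ := Finset.mem_biUnion.1 hp
        exact (Finset.mem_powersetCard.1 hpC).2
    rw [card_biUnion_powersetCard_two h𝒞d h𝒞c h𝒞part] at h
    rw [← h, ← smul_eq_mul, ← Finset.sum_const]
    refine Finset.sum_congr rfl fun B hB => ?_
    rw [← hinner B hB, innerPairs]
    congr 1
    refine Finset.filter_congr fun p hp => ?_
    simp [Finset.mem_biUnion, Finset.mem_powersetCard, (Finset.mem_powersetCard.1 hp).2]
  have two_mul_choose (a : ℕ) : 2 * a.choose 2 = a * (a - 1) := by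
    rw [Nat.choose_two_right, Nat.mul_div_cancel' (Nat.even_mul_pred_self a).two_dvd]
  have hk2 := two_mul_choose k
  have hv2 := two_mul_choose (c * d)
  have hc2 := two_mul_choose c
  have hb : ℬ.card = lam * (c * d) := by
    refine Nat.eq_of_mul_eq_mul_right (show 0 < c * d - 1 by omega) ?_
    calc ℬ.card * (c * d - 1) = 2 * (ℬ.card * k.choose 2) := by rw [hcd, ← hk2]; ring
      _ = lam * (c * d) * (c * d - 1) := by rw [htotal, mul_assoc lam, ← hv2]; ring
  have hpos : 0 < lam * (c * d) := by positivity
  have hn2 : 2 * n = c - 1 := by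
    refine Nat.eq_of_mul_eq_mul_left hpos ?_
    calc lam * (c * d) * (2 * n) = 2 * (ℬ.card * n) := by rw [hb]; ring
      _ = lam * d * (2 * c.choose 2) := by rw [hin]; ring
      _ = lam * (c * d) * (c - 1) := by rw [hc2]; ring
  refine ⟨hn2, ?_⟩
  obtain ⟨B, hB⟩ : ℬ.Nonempty := Finset.card_pos.1 (hb ▸ hpos)
  have hsum := innerPairs_add_outerPairs 𝒞 B
  rw [hinner B hB, houter B hB, hblocksize B hB] at hsum
  have hcm : c * (2 * m + 1) = c * d := by
    have : c * (2 * m + 1) = 2 * (m * c) + c := by ring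
    omega
  have := Nat.eq_of_mul_eq_mul_left (by omega) hcm
  omega

/-- For a block-transitive, point-imprimitive `2`-design with `cd − 1 = k(k−1)`
(e.g. the Singer-cycle examples on `PG₂(q)`), the Delandtsheer–Doyen parameters are
`n = (c−1)/2` and `m = (d−1)/2`; if moreover `G` is cyclic of order `cd` acting regularly
on the points, then `Rank(H) = c = 2n + 1` and `Rank(K) = d = 2m + 1`. -/
theorem singer_cycle_ranks
    {P : Type*} [Fintype P] [DecidableEq P]
    (c d k lam m n : ℕ) (hc : 2 ≤ c) (hd : 2 ≤ d) (hlam : 0 < lam)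
    (hP : Fintype.card P = c * d)
    (ℬ : Finset (Finset P))
    (hblocksize : ∀ B ∈ ℬ, B.card = k)
    (hdesign : ∀ p : Finset P, p.card = 2 → (ℬ.filter fun B => p ⊆ B).card = lam)
    (G : Subgroup (Equiv.Perm P))
    (hGaut : ∀ g ∈ G, ∀ B ∈ ℬ, B.image ⇑g ∈ ℬ)
    (hGtrans : ∀ B₁ ∈ ℬ, ∀ B₂ ∈ ℬ, ∃ g ∈ G, B₁.image ⇑g = B₂)
    (𝒞 : Finset (Finset P))
    (h𝒞d : 𝒞.card = d) (h𝒞c : ∀ C ∈ 𝒞, C.card = c)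
    (h𝒞part : ∀ x : P, ∃! C, C ∈ 𝒞 ∧ x ∈ C)
    (h𝒞inv : ∀ g ∈ G, ∀ C ∈ 𝒞, C.image ⇑g ∈ 𝒞)
    (hm : 0 < m) (hn : 0 < n)
    (hinner : ∀ B ∈ ℬ, innerPairs 𝒞 B = n)
    (houter : ∀ B ∈ ℬ, outerPairs 𝒞 B = m * c)
    (C : Finset P) (hC : C ∈ 𝒞)
    (H : Subgroup (Equiv.Perm {x // x ∈ C}))
    (hH : ∀ h : Equiv.Perm {x // x ∈ C},
      h ∈ H ↔ ∃ g ∈ G, ∀ x : {x // x ∈ C}, (↑(h x) : P) = g ↑x)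
    (K : Subgroup (Equiv.Perm {D // D ∈ 𝒞}))
    (hK : ∀ κ : Equiv.Perm {D // D ∈ 𝒞},
      κ ∈ K ↔ ∃ g ∈ G, ∀ D : {D // D ∈ 𝒞}, (↑(κ D) : Finset P) = (↑D : Finset P).image ⇑g)
    (hcd : c * d - 1 = k * (k - 1)) :
    (2 * n = c - 1 ∧ 2 * m = d - 1) ∧
    (IsCyclic G → Nat.card G = c * d →
      (∀ x y : P, ∃ g ∈ G, g x = y) →
      (∀ g ∈ G, (∃ x : P, g x = x) → g = 1) →
      permRank H = c ∧ c = 2 * n + 1 ∧ permRank K = d ∧ d = 2 * m + 1) := by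
  have hpar := delandtsheer_doyen_parameters hc hd hlam hP hblocksize hdesign h𝒞d h𝒞c h𝒞part
    hinner houter hcd
  refine ⟨hpar, fun hcyc _ htrans hfree => ⟨?_, by omega, ?_, by omega⟩⟩
  · obtain ⟨x₀, hx₀⟩ : C.Nonempty := Finset.card_pos.1 (by rw [h𝒞c C hC]; omega)
    have : Nonempty {x // x ∈ C} := ⟨⟨x₀, hx₀⟩⟩
    rw [permRank_eq_card_of_regular H, Nat.card_eq_fintype_card, Fintype.card_coe, h𝒞c C hC]
    · rintro ⟨x, hx⟩ ⟨y, hy⟩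
      obtain ⟨g, hg, rfl⟩ := htrans x y
      have himage : C.image ⇑g = C := (h𝒞part (g x)).unique
        ⟨h𝒞inv g hg C hC, Finset.mem_image_of_mem g hx⟩ ⟨hC, hy⟩
      have hmem (z : P) : z ∈ C ↔ g z ∈ C := by
        conv_rhs => rw [← himage]
        simp
      exact ⟨g.subtypeEquiv hmem, (hH _).2 ⟨g, hg, fun _ => rfl⟩, rfl⟩
    · rintro h hh ⟨x, hx⟩
      obtain ⟨g, hg, hgh⟩ := (hH h).1 hh
      have h1 := hfree g hg ⟨x, by rw [← hgh x, hx]⟩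
      ext z
      simp [hgh z, h1]
  · have : Nonempty {D // D ∈ 𝒞} := ⟨⟨C, hC⟩⟩
    have hmove (D E : Finset P) (hD : D ∈ 𝒞) (hE : E ∈ 𝒞) : ∃ g ∈ G, D.image ⇑g = E := by
      obtain ⟨x, hx⟩ : D.Nonempty := Finset.card_pos.1 (by rw [h𝒞c D hD]; omega)
      obtain ⟨y, hy⟩ : E.Nonempty := Finset.card_pos.1 (by rw [h𝒞c E hE]; omega)
      obtain ⟨g, hg, rfl⟩ := htrans x y
      exact ⟨g, hg, (h𝒞part (g x)).unique
        ⟨h𝒞inv g hg D hD, Finset.mem_image_of_mem g hx⟩ ⟨hE, hy⟩⟩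
    rw [permRank_eq_card_of_regular K, Nat.card_eq_fintype_card, Fintype.card_coe, h𝒞d]
    · rintro ⟨D, hD⟩ ⟨E, hE⟩
      obtain ⟨g, hg, rfl⟩ := hmove D E hD hE
      have hmem (F : Finset P) : F ∈ 𝒞 ↔ g.finsetCongr F ∈ 𝒞 := by
        rw [Equiv.finsetCongr_apply, Finset.map_eq_image]
        refine ⟨h𝒞inv g hg F, fun hF => ?_⟩
        have := h𝒞inv g⁻¹ (G.inv_mem hg) _ hF
        simpa [Finset.image_image, Function.comp_def] using this
      refine ⟨g.finsetCongr.subtypeEquiv hmem, (hK _).2 ⟨g, hg, fun F => ?_⟩, Subtype.ext ?_⟩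
      · exact Finset.map_eq_image _ _
      · exact Finset.map_eq_image _ _
    · rintro κ hκ ⟨D, hD⟩
      obtain ⟨g, hg, hgκ⟩ := (hK κ).1 hκ
      have hfix : (D : Finset P).image ⇑g = D := by rw [← hgκ D, hD]
      refine Equiv.ext fun E => Subtype.ext ?_
      obtain ⟨a, ha, haE⟩ := hmove D E D.2 E.2
      have hcomm : g * a = a * g :=
        congrArg Subtype.val (IsCyclic.isMulCommutative.is_comm.comm (⟨g, hg⟩ : G) ⟨a, ha⟩)
      rw [hgκ E, Equiv.Perm.one_apply, ← haE, Finset.image_image, ← Equiv.Perm.coe_mul, hcomm,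
        Equiv.Perm.coe_mul, ← Finset.image_image, hfix]
end

section
/- If n ∈ {6, 10, 15}, then there is no useful pair [n,c]; that is, there is no prime power c with c ≡ 1 (mod 2n) such that c + n = k(k−1)/2 for some integer k ≥ 2n. Moreover, if n ∈ {6, 10, 15} and c is a prime power with c ≡ 1 (mod 2n) satisfying c + n = k(k−1)/2 for some integer k ≥ 2 (with the condition k ≥ 2n dropped), then (n, c, k) is one of (6, 49, 11), (10, 81, 14), (15, 121, 17), and in each case d = 1 + (c−1)/n = 9. -/
theorem dvd_two_of_dvd_two_mul_prime_pow {p e y : ℕ} (hp : p.Prime) (hy : y ∣ 2 * p ^ e)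
    (h : ¬ p ∣ y) : y ∣ 2 :=
  Nat.Coprime.dvd_of_dvd_mul_right
    (((Nat.Prime.coprime_iff_not_dvd hp).2 h).symm.pow_right e) hy

theorem le_two_or_dvd_of_mul_add_dvd {p e x q : ℕ} (hp : p.Prime)
    (h : x * (x + q) ∣ 2 * p ^ e) : x ≤ 2 ∨ (p ∣ x ∧ p ∣ q) := by
  by_cases hx : p ∣ x
  · by_cases hy : p ∣ x + q
    · exact Or.inr ⟨hx, (Nat.dvd_add_right hx).1 hy⟩
    · have := Nat.le_of_dvd two_pos
        (dvd_two_of_dvd_two_mul_prime_pow hp ((Dvd.intro_left _ rfl).trans h) hy)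
      omega
  · exact Or.inl (Nat.le_of_dvd two_pos
      (dvd_two_of_dvd_two_mul_prime_pow hp ((Dvd.intro _ rfl).trans h) hx))

theorem two_mul_choose_two_succ (m : ℕ) : 2 * (m + 1).choose 2 = (m + 1) * m := by
  rw [Nat.choose_two_right, Nat.add_sub_cancel]
  exact Nat.mul_div_cancel' (by simpa [mul_comm] using (Nat.even_mul_succ_self m).two_dvd)

/-- If a positive `c` is the difference of the triangular numbers `k.choose 2` and
`(t + 1).choose 2`, then `2 * c` factors as `(k - (t + 1)) * (k + t)`. -/
theorem exists_mul_add_eq_two_mul {c k t : ℕ} (hc : 0 < c)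
    (h : c + (t + 1).choose 2 = k.choose 2) :
    ∃ x, k = x + (t + 1) ∧ x * (x + (2 * t + 1)) = 2 * c := by
  have hk : t + 1 ≤ k := by
    by_contra! hlt
    have := Nat.choose_le_choose 2 hlt.le
    omega
  obtain ⟨x, rfl⟩ := Nat.exists_eq_add_of_le' hk
  refine ⟨x, rfl, ?_⟩
  have h1 := two_mul_choose_two_succ t
  have h2 := two_mul_choose_two_succ (x + t)
  rw [add_assoc] at h2
  nlinarith

theorem eq_of_isPrimePow_add_six {c k : ℕ} (hc : IsPrimePow c) (hmod : c % 12 = 1)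
    (h : c + 6 = k.choose 2) : c = 49 ∧ k = 11 := by
  obtain ⟨x, rfl, hx⟩ := exists_mul_add_eq_two_mul (t := 3) hc.pos h
  obtain ⟨p, e, hp, -, rfl⟩ := (isPrimePow_nat_iff _).1 hc
  rcases le_two_or_dvd_of_mul_add_dvd hp (Dvd.intro 1 (by simpa using hx)) with h2 | ⟨hpx, hpq⟩
  · interval_cases x <;> omega
  · obtain rfl := (Nat.prime_dvd_prime_iff_eq hp (by norm_num)).1 hpq
    obtain ⟨y, rfl⟩ := hpx
    have hy : y * (y + 1) ∣ 2 * 7 ^ e := ⟨49, by rw [← hx]; ring⟩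
    rcases le_two_or_dvd_of_mul_add_dvd hp hy with h2 | ⟨-, h1⟩
    · interval_cases y <;> omega
    · norm_num at h1

theorem eq_of_isPrimePow_add_ten {c k : ℕ} (hc : IsPrimePow c) (hmod : c % 20 = 1)
    (h : c + 10 = k.choose 2) : c = 81 ∧ k = 14 := by
  obtain ⟨x, rfl, hx⟩ := exists_mul_add_eq_two_mul (t := 4) hc.pos h
  obtain ⟨p, e, hp, -, rfl⟩ := (isPrimePow_nat_iff _).1 hc
  rcases le_two_or_dvd_of_mul_add_dvd hp (Dvd.intro 1 (by simpa using hx)) with h2 | ⟨hpx, hpq⟩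
  · interval_cases x <;> omega
  · obtain rfl := (Nat.prime_dvd_prime_iff_eq hp (by norm_num)).1
      (hp.dvd_of_dvd_pow (show p ∣ 3 ^ 2 from hpq))
    obtain ⟨y, rfl⟩ := hpx
    have hy : y * (y + 3) ∣ 2 * 3 ^ e := ⟨9, by rw [← hx]; ring⟩
    rcases le_two_or_dvd_of_mul_add_dvd hp hy with h2 | ⟨⟨z, rfl⟩, -⟩
    · interval_cases y <;> omega
    · have hz : z * (z + 1) ∣ 2 * 3 ^ e := ⟨81, by rw [← hx]; ring⟩
      rcases le_two_or_dvd_of_mul_add_dvd hp hz with h2 | ⟨-, h1⟩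
      · interval_cases z <;> omega
      · norm_num at h1

theorem eq_of_isPrimePow_add_fifteen {c k : ℕ} (hc : IsPrimePow c) (hmod : c % 30 = 1)
    (h : c + 15 = k.choose 2) : c = 121 ∧ k = 17 := by
  obtain ⟨x, rfl, hx⟩ := exists_mul_add_eq_two_mul (t := 5) hc.pos h
  obtain ⟨p, e, hp, -, rfl⟩ := (isPrimePow_nat_iff _).1 hc
  rcases le_two_or_dvd_of_mul_add_dvd hp (Dvd.intro 1 (by simpa using hx)) with h2 | ⟨hpx, hpq⟩
  · interval_cases x <;> omega
  · obtain rfl := (Nat.prime_dvd_prime_iff_eq hp (by norm_num)).1 hpq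
    obtain ⟨y, rfl⟩ := hpx
    have hy : y * (y + 1) ∣ 2 * 11 ^ e := ⟨121, by rw [← hx]; ring⟩
    rcases le_two_or_dvd_of_mul_add_dvd hp hy with h2 | ⟨-, h1⟩
    · interval_cases y <;> omega
    · norm_num at h1

/-- For `n ∈ {6, 10, 15}` there is no useful pair `[n, c]`; moreover, if the condition
`k ≥ 2n` is dropped, the only solutions are `(n, c, k) = (6, 49, 11)`, `(10, 81, 14)`,
`(15, 121, 17)`, each with `d = 1 + (c−1)/n = 9`. -/
theorem no_useful_pair_for_6_10_15 (n : ℕ) (hn : n = 6 ∨ n = 10 ∨ n = 15) :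
    (¬ ∃ c k : ℕ, IsPrimePow c ∧ c % (2 * n) = 1 ∧ c + n = Nat.choose k 2 ∧ 2 * n ≤ k) ∧
    (∀ c k : ℕ, IsPrimePow c → c % (2 * n) = 1 → c + n = Nat.choose k 2 → 2 ≤ k →
      ((n = 6 ∧ c = 49 ∧ k = 11) ∨ (n = 10 ∧ c = 81 ∧ k = 14) ∨
        (n = 15 ∧ c = 121 ∧ k = 17)) ∧ 1 + (c - 1) / n = 9) := by
  have key : ∀ c k : ℕ, IsPrimePow c → c % (2 * n) = 1 → c + n = Nat.choose k 2 →
      (n = 6 ∧ c = 49 ∧ k = 11) ∨ (n = 10 ∧ c = 81 ∧ k = 14) ∨ (n = 15 ∧ c = 121 ∧ k = 17) := by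
    intro c k hc hmod h
    rcases hn with rfl | rfl | rfl
    · exact Or.inl ⟨rfl, eq_of_isPrimePow_add_six hc hmod h⟩
    · exact Or.inr (Or.inl ⟨rfl, eq_of_isPrimePow_add_ten hc hmod h⟩)
    · exact Or.inr (Or.inr ⟨rfl, eq_of_isPrimePow_add_fifteen hc hmod h⟩)
  constructor
  · rintro ⟨c, k, hc, hmod, h, hk⟩
    have := key c k hc hmod h
    omega
  · intro c k hc hmod h _
    refine ⟨key c k hc hmod h, ?_⟩
    rcases key c k hc hmod h with ⟨rfl, rfl, rfl⟩ | ⟨rfl, rfl, rfl⟩ | ⟨rfl, rfl, rfl⟩ <;> rfl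
end
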